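/- arXiv:2407.04556 — 11 statements merged into one kernel-verified Lean document; each statement's English description precedes it below -/
import Mathlib

section
/- Let q be an odd prime power with char(F_q) > 3 and q ≡ 3 (mod 4), and let d ∈ F_q with d ≠ 0. Then there exists y ∈ F_q such that det[(a + d·b)^{(q+3)/2}]_{a,b ∈ S} = (−1)^{(q−3)/4} · 3 · d^{(q+1)/4} · y². -/
open Finset Matrix in
theorem det_of_pow_rev {R : Type*} [CommRing R] {m : ℕ} (v : Fin (2 * m + 1) → R) :
    (Matrix.of fun i j => v i ^ (j.rev : ℕ)).det = (-1) ^ m * (vandermonde v).det := by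
  have hproj : (Matrix.of fun i j => v i ^ (j.rev : ℕ)) = projVandermonde 1 v := by
    ext i j
    simp [projVandermonde_apply]
  have hcard : ∑ i : Fin (2 * m + 1), #(Ioi i) = (2 * m + 1) * m := by
    simp only [Fin.card_Ioi]
    rw [Fin.sum_univ_eq_sum_range (fun i => 2 * m + 1 - 1 - i),
      sum_range_reflect (fun i => i), sum_range_id]
    rw [Nat.add_sub_cancel, mul_left_comm]
    simp
  have hneg : ∀ i : Fin (2 * m + 1), ∏ j ∈ Ioi i, (v i - v j)
      = (-1) ^ #(Ioi i) * ∏ j ∈ Ioi i, (v j - v i) := fun i => by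
    rw [← prod_const, ← prod_mul_distrib]
    exact prod_congr rfl fun j _ => by ring
  rw [hproj, det_projVandermonde, det_vandermonde]
  simp only [Pi.one_apply, one_mul, hneg]
  rw [prod_mul_distrib, prod_pow_eq_pow_sum, hcard, pow_mul,
    Odd.neg_one_pow (odd_two_mul_add_one m)]

/-- The coefficients of `(a + d * b) ^ (n + 2)` after reducing exponents by `a ^ n = b ^ n = 1`. -/
def foldedCoeff {R : Type*} [CommRing R] (n : ℕ) (d : R) (k : ℕ) : R :=
  (n + 2).choose k * d ^ k + if k < 3 then (n + 2).choose (n + k) * d ^ (n + k) else 0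

open Finset in
theorem add_mul_pow_eq_sum_foldedCoeff {R : Type*} [CommRing R] {n : ℕ} (hn : 3 ≤ n) {a b : R}
    (d : R) (ha : a ^ n = 1) (hb : b ^ n = 1) :
    (a + d * b) ^ (n + 2)
      = a ^ 3 * ∑ k ∈ range n, foldedCoeff n d k * a ^ (n - 1 - k) * b ^ k := by
  have htail : ∑ k ∈ range n, (if k < 3 then ((n + 2).choose (n + k) : R) * d ^ (n + k) else 0)
        * a ^ (n - 1 - k) * b ^ k
      = ∑ k ∈ range 3, ((n + 2).choose (n + k) : R) * d ^ (n + k) * a ^ (n - 1 - k) * b ^ k := by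
    rw [← sum_subset (range_subset_range.2 hn)]
    · exact sum_congr rfl fun k hk => by rw [if_pos (mem_range.1 hk)]
    · intro k _ hk
      rw [if_neg (by simpa using hk)]
      ring
  simp only [foldedCoeff, add_mul, sum_add_distrib]
  rw [htail, add_comm a, add_pow, show n + 2 + 1 = n + 3 from rfl, sum_range_add, mul_add, mul_sum,
    mul_sum]
  congr 1
  · refine sum_congr rfl fun k hk => ?_
    have hk := mem_range.1 hk
    rw [show n + 2 - k = 3 + (n - 1 - k) by omega]
    ring
  · refine sum_congr rfl fun k hk => ?_
    have hk := mem_range.1 hk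
    have hpow : a ^ 3 * a ^ (n - 1 - k) = a ^ (2 - k) := by
      rw [← pow_add, show 3 + (n - 1 - k) = n + (2 - k) by omega, pow_add, ha, one_mul]
    rw [show n + 2 - (n + k) = 2 - k by omega, ← hpow, mul_pow, pow_add b, hb]
    ring

open Finset Matrix in
theorem det_add_mul_pow {R : Type*} [CommRing R] {m : ℕ} (hm : 1 ≤ m) (d : R)
    (v : Fin (2 * m + 1) → R) (hv : ∀ i, v i ^ (2 * m + 1) = 1) :
    (Matrix.of fun i j => (v i + d * v j) ^ (2 * m + 1 + 2)).det
      = (-1) ^ m * (∏ i, v i) ^ 3 * (∏ k ∈ range (2 * m + 1), foldedCoeff (2 * m + 1) d k)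
        * (vandermonde v).det ^ 2 := by
  have hfac : (Matrix.of fun i j => (v i + d * v j) ^ (2 * m + 1 + 2))
      = Matrix.of fun i j => v i ^ 3 * ((Matrix.of fun i j : Fin (2 * m + 1) => v i ^ (j.rev : ℕ))
          * diagonal (fun k : Fin (2 * m + 1) => foldedCoeff (2 * m + 1) d k)
          * (vandermonde v)ᵀ) i j := by
    ext i j
    rw [of_apply, of_apply, add_mul_pow_eq_sum_foldedCoeff (by omega) d (hv i) (hv j), mul_apply,
      ← Fin.sum_univ_eq_sum_range
        (fun k => foldedCoeff (2 * m + 1) d k * v i ^ (2 * m + 1 - 1 - k) * v j ^ k)]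
    congr 1
    refine sum_congr rfl fun k _ => ?_
    rw [mul_diagonal, transpose_apply, vandermonde_apply, of_apply, Fin.val_rev,
      show 2 * m + 1 - 1 - (k : ℕ) = 2 * m + 1 - (k + 1) by omega]
    ring
  rw [hfac, det_mul_column, det_mul, det_mul, det_transpose, det_diagonal, det_of_pow_rev,
    prod_pow, Fin.prod_univ_eq_prod_range (foldedCoeff (2 * m + 1) d)]
  ring

open Finset in
theorem isSquare_prod_range_of_symm {R : Type*} [CommMonoid R] {r : ℕ} {f : ℕ → R}
    (hf : ∀ j < r, f (r + j) = f (r - 1 - j)) : IsSquare (∏ j ∈ range (2 * r), f j) := by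
  refine ⟨∏ j ∈ range r, f j, ?_⟩
  rw [two_mul, prod_range_add, prod_congr rfl fun j hj => hf j (mem_range.1 hj),
    prod_range_reflect]

open Finset in
/-- When `d` is a square with `d ^ n = 1`, the coefficients with index at least `3` pair off, and
so do those with index `0` and `2`. -/
theorem exists_prod_foldedCoeff_eq {R : Type*} [CommRing R] {m : ℕ} (hm : 1 ≤ m) {s : R}
    (hs : (s * s) ^ (2 * m + 1) = 1) :
    ∃ y, ∏ k ∈ range (2 * m + 1), foldedCoeff (2 * m + 1) (s * s) k = (4 * m + 6 : ℕ) * y ^ 2 := by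
  obtain ⟨r, rfl⟩ : ∃ r, m = r + 1 := ⟨m - 1, by omega⟩
  set n := 2 * (r + 1) + 1 with hn
  have hchoose : ∀ j < r, (n + 2).choose (r + j + 3) = (n + 2).choose (r - 1 - j + 3) := by
    intro j hj
    rw [← Nat.choose_symm (show r - 1 - j + 3 ≤ n + 2 by omega)]
    congr 1
    omega
  obtain ⟨u, hu⟩ : IsSquare (∏ k ∈ range (2 * r), foldedCoeff n (s * s) (k + 3)) := by
    have hc : ∀ k, foldedCoeff n (s * s) (k + 3)
        = ((n + 2).choose (k + 3) : R) * (s ^ (k + 3) * s ^ (k + 3)) := by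
      intro k
      simp [foldedCoeff, mul_pow]
    simp only [hc]
    rw [prod_mul_distrib, prod_mul_distrib]
    exact (isSquare_prod_range_of_symm (fun j hj => by rw [hchoose j hj])).mul ⟨_, rfl⟩
  have h2 : (n + 2).choose n = (n + 2).choose 2 := Nat.choose_symm_add
  have h1 : (n + 2).choose (n + 1) = n + 2 := Nat.choose_succ_self_right (n + 1)
  have hprod : ∏ k ∈ range n, foldedCoeff n (s * s) k
      = (∏ k ∈ range (2 * r), foldedCoeff n (s * s) (k + 3)) * foldedCoeff n (s * s) 2
        * foldedCoeff n (s * s) 1 * foldedCoeff n (s * s) 0 := by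
    rw [show n = 2 * r + 1 + 1 + 1 by omega, prod_range_succ', prod_range_succ', prod_range_succ']
  have hcoeff : (4 * (r + 1) + 6 : ℕ) = 2 * (n + 2) := by omega
  refine ⟨u * s ^ 3 * (1 + (n + 2).choose 2), ?_⟩
  rw [hprod, hu, hcoeff]
  simp only [foldedCoeff, pow_add _ n, hs, add_zero, h1, h2, Nat.choose_zero_right, Nat.choose_self,
    Nat.choose_one_right]
  norm_num
  ring

section FiniteField

variable {F : Type*} [Field F] [Fintype F] [DecidableEq F]

open Finset in
/-- In a finite field of order `4 * m + 3` there are `2 * m + 1` nonzero squares. -/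
theorem card_nonzero_isSquare {m : ℕ} (hF : ringChar F ≠ 2) (hcard : Fintype.card F = 4 * m + 3) :
    Fintype.card {x : F // x ≠ 0 ∧ IsSquare x} = 2 * m + 1 := by
  have hhalf : Fintype.card F / 2 = 2 * m + 1 := by omega
  have hne : (-1 : F) ≠ 1 := Ring.neg_one_ne_one_of_char_ne_two hF
  have hneg : ∀ x : F, x ≠ 0 → (IsSquare (-x) ↔ ¬ IsSquare x) := by
    intro x hx
    rw [FiniteField.isSquare_iff hF hx, FiniteField.isSquare_iff hF (neg_ne_zero.2 hx), hhalf,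
      (odd_two_mul_add_one m).neg_pow]
    rcases FiniteField.pow_dichotomy hF hx with h | h <;> rw [hhalf] at h <;> rw [h] <;>
      simp [hne]
  have heq : #{x : F | x ≠ 0 ∧ IsSquare x} = #{x : F | x ≠ 0 ∧ ¬ IsSquare x} := by
    refine card_equiv (Equiv.neg F) fun x => ?_
    by_cases hx : x = 0
    · simp [hx]
    · simp [hx, hneg x hx]
  have hsum := card_filter_add_card_filter_not (s := univ.erase (0 : F)) (fun x => IsSquare x)
  rw [card_erase_of_mem (mem_univ _), card_univ, hcard] at hsum
  have h1 : (univ.erase (0 : F)).filter (fun x => IsSquare x)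
      = ({x : F | x ≠ 0 ∧ IsSquare x} : Finset F) := by ext; simp
  have h2 : (univ.erase (0 : F)).filter (fun x => ¬ IsSquare x)
      = ({x : F | x ≠ 0 ∧ ¬ IsSquare x} : Finset F) := by ext; simp
  rw [h1, h2] at hsum
  rw [Fintype.card_subtype]
  omega

end FiniteField

/-- Let `q` be an odd prime power with `char(F_q) > 3` and `q ≡ 3 (mod 4)`,
and let `d ∈ F_q`, `d ≠ 0`. Then there exists `y ∈ F_q` such that
`det[(a + d·b)^((q+3)/2)]_{a,b ∈ S} = (−1)^((q−3)/4) · 3 · d^((q+1)/4) · y²`,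
where `S` is the set of nonzero squares of `F_q`. -/
theorem stmt1 {F : Type*} [Field F] [Fintype F] [DecidableEq F] (q : ℕ)
    (hcard : Fintype.card F = q) (hodd : Odd q) (hchar : 3 < ringChar F)
    (hmod : q % 4 = 3) (d : F) (hd : d ≠ 0) :
    ∃ y : F,
      (Matrix.of (fun a b : {x : F // x ≠ 0 ∧ IsSquare x} =>
          ((a : F) + d * (b : F)) ^ ((q + 3) / 2))).det
        = (-1 : F) ^ ((q - 3) / 4) * 3 * d ^ ((q + 1) / 4) * y ^ 2 := by
  obtain ⟨m, rfl⟩ : ∃ m, q = 4 * m + 3 := ⟨q / 4, by omega⟩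
  have hF : ringChar F ≠ 2 := by omega
  have hhalf : Fintype.card F / 2 = 2 * m + 1 := by omega
  have hm : 1 ≤ m := by
    by_contra! h
    have hdvd : ringChar F ∣ 3 := by
      rw [← CharP.cast_eq_zero_iff F, show 3 = Fintype.card F by omega,
        FiniteField.cast_card_eq_zero]
    exact absurd (Nat.le_of_dvd (by norm_num) hdvd) (by omega)
  let e := (Fintype.equivFinOfCardEq (card_nonzero_isSquare hF hcard)).symm
  have hv : ∀ i, ((e i : F)) ^ (2 * m + 1) = 1 := fun i => by
    have h := (FiniteField.isSquare_iff hF (e i).2.1).1 (e i).2.2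
    rwa [hhalf] at h
  have hdet := det_add_mul_pow hm d (fun i => (e i : F)) hv
  rw [show (4 * m + 3 + 3) / 2 = 2 * m + 1 + 2 by omega, show (4 * m + 3 - 3) / 4 = m by omega,
    show (4 * m + 3 + 1) / 4 = m + 1 by omega, ← Matrix.det_submatrix_equiv_self e]
  change ∃ y, (Matrix.of fun i j => ((e i : F) + d * (e j : F)) ^ (2 * m + 1 + 2)).det = _
  rw [hdet]
  rcases FiniteField.pow_dichotomy hF hd with h | h
  · obtain ⟨s, rfl⟩ := (FiniteField.isSquare_iff hF hd).2 h
    rw [hhalf] at h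
    have hs : s ≠ 0 := by rintro rfl; simp at hd
    obtain ⟨w, hw⟩ : IsSquare (∏ i, (e i : F)) := by
      choose w hw using fun i => (e i).2.2
      exact ⟨∏ i, w i, by rw [← Finset.prod_mul_distrib]; exact Finset.prod_congr rfl fun i _ => hw i⟩
    obtain ⟨z, hz⟩ := exists_prod_foldedCoeff_eq hm h
    have hthree : ((4 * m + 6 : ℕ) : F) = 3 := by
      have h0 := FiniteField.cast_card_eq_zero F
      rw [hcard] at h0
      push_cast at h0 ⊢
      linear_combination h0
    refine ⟨w ^ 3 * z * (Matrix.vandermonde fun i => (e i : F)).det / s ^ (m + 1), ?_⟩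
    rw [hw, hz, hthree]
    field_simp
    ring
  · rw [hhalf] at h
    refine ⟨0, ?_⟩
    have hzero : foldedCoeff (2 * m + 1) d 1 = 0 := by
      rw [foldedCoeff, if_pos (by norm_num), Nat.choose_one_right,
        show (2 * m + 1 + 2).choose (2 * m + 1 + 1) = 2 * m + 1 + 2 from
          Nat.choose_succ_self_right _, pow_add _ (2 * m + 1), h]
      ring
    rw [Finset.prod_eq_zero (Finset.mem_range.2 (by omega : 1 < 2 * m + 1)) hzero]
    ring
end

section
/- Let q be an odd prime power with char(F_q) > 7 and q ≡ 1 (mod 4), and let d ∈ F_q with d ≠ 0. Then there exists x ∈ F_q such that det[(a + d·b)^{q−6}]_{a,b ∈ S} = d^{(q−1)/4} · x². -/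
open Finset in
theorem sum_range_add_self_choose_mul_pow {R : Type*} [CommRing R] {e n : ℕ} (he : e < n + n)
    (t : R) :
    (t + 1) ^ e = ∑ k ∈ range n, ((e.choose k : R) + t ^ n * e.choose (n + k)) * t ^ k := by
  have hsub : range (e + 1) ⊆ range (n + n) := by
    intro j hj
    simp only [mem_range] at *
    omega
  rw [add_pow, sum_subset hsub, sum_range_add, ← sum_add_distrib]
  · refine sum_congr rfl fun k _ => ?_
    simp only [one_pow, mul_one, pow_add]
    ring
  · intro j _ hj
    rw [Nat.choose_eq_zero_of_lt (by simpa using hj)]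
    simp

open Finset in
theorem prod_range_add_self_of_reflect {M : Type*} [CommMonoid M] (h : ℕ) (u : ℕ → M) (ε : M)
    (hu : ∀ k < h, u (h + h - 1 - k) = ε * u k) :
    ∏ k ∈ range (h + h), u k = ε ^ h * (∏ k ∈ range h, u k) ^ 2 := by
  have hreflect : ∏ k ∈ range h, u (h + k) = ε ^ h * ∏ k ∈ range h, u k := by
    rw [← prod_range_reflect]
    calc ∏ j ∈ range h, u (h + (h - 1 - j)) = ∏ j ∈ range h, ε * u j := by
          refine prod_congr rfl fun k hk => ?_
          have hk := mem_range.mp hk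
          rw [← hu k hk]
          congr 1
          omega
      _ = _ := by simp [prod_mul_distrib]
  rw [prod_range_add, hreflect, sq, mul_left_comm]

open Finset in
theorem isSquare_prod_choose_add_mul_choose {R : Type*} [CommRing R] (h : ℕ) {ε : R}
    (hε : IsSquare ε) (hε2 : ε * ε = 1) :
    IsSquare (∏ k ∈ range (h + h + 4), (((4 * h + 3).choose k : R) +
      ε * (4 * h + 3).choose (h + h + 4 + k))) := by
  rw [prod_range_add]
  refine IsSquare.mul ?_ ?_
  · rw [prod_range_add_self_of_reflect h _ ε]
    · exact (hε.pow h).mul (IsSquare.sq _)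
    · intro k hk
      rw [Nat.choose_symm_of_eq_add (show 4 * h + 3 = (h + h - 1 - k) + (h + h + 4 + k) by omega),
        ← Nat.choose_symm_of_eq_add
          (show 4 * h + 3 = k + (h + h + 4 + (h + h - 1 - k)) by omega)]
      linear_combination (-((4 * h + 3).choose (h + h + 4 + k) : R)) * hε2
  · have hz (i : ℕ) : (4 * h + 3).choose (h + h + 4 + (h + h + i)) = 0 :=
      Nat.choose_eq_zero_of_lt (by omega)
    simp only [hz, Nat.cast_zero, mul_zero, add_zero]
    rw [prod_range_add_self_of_reflect 2 _ 1]
    · simpa using IsSquare.sq _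
    · intro k hk
      rw [Nat.choose_symm_of_eq_add
        (show 4 * h + 3 = (h + h + (2 + 2 - 1 - k)) + (h + h + k) by omega), one_mul]

theorem isSquare_det_vandermonde_inv_mul_det_vandermonde {F : Type*} [Field F] {n : ℕ}
    (h : IsSquare (-1 : F)) (v : Fin n → F) (hv : ∀ i, v i ≠ 0 ∧ IsSquare (v i)) :
    IsSquare ((Matrix.vandermonde fun i => (v i)⁻¹).det * (Matrix.vandermonde v).det) := by
  simp only [Matrix.det_vandermonde, ← Finset.prod_mul_distrib]
  refine Finset.isSquare_prod _ fun i _ => Finset.isSquare_prod _ fun j _ => ?_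
  have key : ((v j)⁻¹ - (v i)⁻¹) * (v j - v i) =
      -1 * (v i)⁻¹ * (v j)⁻¹ * (v j - v i) ^ 2 := by
    have := (hv i).1
    have := (hv j).1
    field_simp
    ring
  rw [key]
  exact ((h.mul (hv i).2.inv).mul (hv j).2.inv).mul (IsSquare.sq _)

theorem card_ne_zero_isSquare {F : Type*} [Field F] [Fintype F] (h : Odd (Fintype.card F)) :
    Nat.card {x : F // x ≠ 0 ∧ IsSquare x} = (Fintype.card F - 1) / 2 := by
  have e : (powMonoidHom 2 : Fˣ →* Fˣ).range ≃ {x : F // x ≠ 0 ∧ IsSquare x} :=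
    Equiv.ofBijective
      (fun u => ⟨(u : Fˣ), (u : Fˣ).ne_zero, by
        obtain ⟨_, w, rfl⟩ := u
        exact ⟨w, by simp [sq]⟩⟩) <| by
      constructor
      · intro u w huw
        exact Subtype.ext (Units.ext (congrArg Subtype.val huw))
      · rintro ⟨_, hx, y, rfl⟩
        have hy : y ≠ 0 := left_ne_zero_of_mul hx
        exact ⟨⟨Units.mk0 y hy ^ 2, Units.mk0 y hy, rfl⟩, Subtype.ext (by simp [sq])⟩
  rw [← Nat.card_congr e, IsCyclic.card_powMonoidHom_range, Nat.card_units,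
    Nat.card_eq_fintype_card, Nat.gcd_eq_right]
  obtain ⟨k, hk⟩ := h
  exact ⟨k, by omega⟩

theorem det_add_mul_pow_s3 {F : Type*} [Field F] {e n : ℕ} (he : e < n + n) (d : F) (v : Fin n → F)
    (hv : ∀ i, v i ≠ 0) (hvn : ∀ i, v i ^ n = 1) :
    (Matrix.of fun i j => (v i + d * v j) ^ e).det =
      (∏ i, v i) ^ e * ((Matrix.vandermonde fun i => (v i)⁻¹).det * (Matrix.vandermonde v).det) *
      ((∏ k ∈ Finset.range n, d ^ k) *
        ∏ k ∈ Finset.range n, ((e.choose k : F) + d ^ n * e.choose (n + k))) := by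
  have hfactor : (Matrix.of fun i j => (v i + d * v j) ^ e) =
      Matrix.diagonal (fun i => v i ^ e) * ((Matrix.vandermonde fun i => (v i)⁻¹) *
        Matrix.diagonal (fun k : Fin n =>
          d ^ (k : ℕ) * ((e.choose k : F) + d ^ n * e.choose (n + k))) *
        (Matrix.vandermonde v).transpose) := by
    ext i j
    rw [Matrix.diagonal_mul, Matrix.mul_apply]
    simp only [Matrix.mul_diagonal, Matrix.transpose_apply, Matrix.vandermonde_apply,
      Matrix.of_apply]
    have hsplit : v i + d * v j = v i * (d * v j * (v i)⁻¹ + 1) := by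
      have := hv i
      field_simp
      ring
    have hpow : (d * v j * (v i)⁻¹) ^ n = d ^ n := by
      rw [mul_pow, mul_pow, inv_pow, hvn, hvn]
      simp
    rw [hsplit, mul_pow, sum_range_add_self_choose_mul_pow he, hpow, Finset.sum_range]
    congr 1
    refine Finset.sum_congr rfl fun k _ => ?_
    rw [mul_pow, mul_pow]
    ring
  rw [hfactor]
  simp only [Matrix.det_mul, Matrix.det_diagonal, Matrix.det_transpose, Finset.prod_range,
    Finset.prod_mul_distrib, Finset.prod_pow]
  ring

theorem exists_prod_range_pow_eq {M : Type*} [CommMonoid M] (d : M) (m : ℕ) (hm : 0 < m) :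
    ∃ x, ∏ k ∈ Finset.range (m + m), d ^ k = d ^ m * x ^ 2 := by
  refine ⟨d ^ (m * (m - 1)), ?_⟩
  obtain ⟨m, rfl⟩ : ∃ l, m = l + 1 := ⟨m - 1, by omega⟩
  rw [Finset.prod_pow_eq_pow_sum, Finset.sum_range_id, ← pow_mul, ← pow_add]
  congr 1
  refine Nat.div_eq_of_eq_mul_left two_pos ?_
  simp only [show m + 1 + (m + 1) - 1 = 2 * m + 1 by omega, Nat.add_sub_cancel]
  ring

/-- Let `q` be an odd prime power with `char(F_q) > 7` and `q ≡ 1 (mod 4)`,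
and let `d ∈ F_q`, `d ≠ 0`. Then there exists `x ∈ F_q` such that
`det[(a + d·b)^(q−6)]_{a,b ∈ S} = d^((q−1)/4) · x²`,
where `S` is the set of nonzero squares of `F_q`. -/
theorem stmt3 {F : Type*} [Field F] [Fintype F] [DecidableEq F] (q : ℕ)
    (hcard : Fintype.card F = q) (hodd : Odd q) (hchar : 7 < ringChar F)
    (hmod : q % 4 = 1) (d : F) (hd : d ≠ 0) :
    ∃ x : F,
      (Matrix.of (fun a b : {x : F // x ≠ 0 ∧ IsSquare x} =>
          ((a : F) + d * (b : F)) ^ (q - 6))).det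
        = d ^ ((q - 1) / 4) * x ^ 2 := by
  have hq : 7 < q := by
    have hdvd : ringChar F ∣ q := by
      rw [← hcard]
      exact ringChar.dvd (FiniteField.cast_card_eq_zero F)
    exact hchar.trans_le (Nat.le_of_dvd hodd.pos hdvd)
  obtain ⟨h, rfl⟩ : ∃ h, q = 4 * h + 9 := ⟨(q - 9) / 4, by omega⟩
  have hF : ringChar F ≠ 2 := by omega
  have hneg : IsSquare (-1 : F) := FiniteField.isSquare_neg_one_iff.mpr (by omega)
  have hhalf : Fintype.card F / 2 = h + h + 4 := by omega
  have hS : Nat.card {x : F // x ≠ 0 ∧ IsSquare x} = h + h + 4 := by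
    rw [card_ne_zero_isSquare (hcard ▸ hodd)]
    omega
  let σ : Fin (h + h + 4) ≃ {x : F // x ≠ 0 ∧ IsSquare x} := (Finite.equivFinOfCardEq hS).symm
  let v : Fin (h + h + 4) → F := fun i => σ i
  have hv (i) : v i ≠ 0 ∧ IsSquare (v i) := (σ i).2
  have hvn (i) : v i ^ (h + h + 4) = 1 :=
    hhalf ▸ (FiniteField.isSquare_iff hF (hv i).1).mp (hv i).2
  have hε : IsSquare (d ^ (h + h + 4)) :=
    (show Even (h + h + 4) from ⟨h + 2, by omega⟩).isSquare_pow d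
  have hε2 : d ^ (h + h + 4) * d ^ (h + h + 4) = 1 := by
    rw [← pow_add, ← FiniteField.pow_card_sub_one_eq_one d hd]
    congr 1
    omega
  obtain ⟨x, hx⟩ := exists_prod_range_pow_eq d (h + 2) (by omega)
  rw [show h + 2 + (h + 2) = h + h + 4 by omega] at hx
  obtain ⟨y, hy⟩ := isSquare_prod_choose_add_mul_choose h hε hε2
  obtain ⟨z, hz⟩ := ((Finset.isSquare_prod (s := Finset.univ) v fun i _ => (hv i).2).pow (4 * h + 3)).mul
    (isSquare_det_vandermonde_inv_mul_det_vandermonde hneg v hv)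
  refine ⟨x * y * z, ?_⟩
  rw [← Matrix.det_submatrix_equiv_self σ, show 4 * h + 9 - 6 = 4 * h + 3 by omega,
    show (4 * h + 9 - 1) / 4 = h + 2 by omega]
  refine (det_add_mul_pow_s3 (by omega) d v (fun i => (hv i).1) hvn).trans ?_
  rw [hx, hy, hz]
  ring
end

section
/- Let p > 7 be a prime and let d be an integer with Legendre symbol (d/p) = 1. If the Legendre symbol (T_{(p−11)/2}(d,p)/p) equals −1, then p is congruent to 1, 2, or 4 modulo 7. -/
/-- `T_m(d,p) = det[(i² + d·j²)^m · ((i² + d·j²)/p)]_{1 ≤ i,j ≤ (p−1)/2}`, where the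
Legendre symbol is expressed via the Jacobi symbol (they agree for odd primes `p`). -/
def Tdet (d : ℤ) (p m : ℕ) : ℤ :=
  (Matrix.of (fun i j : Fin ((p - 1) / 2) =>
    (((i : ℕ) + 1 : ℤ) ^ 2 + d * ((j : ℕ) + 1 : ℤ) ^ 2) ^ m *
      jacobiSym (((i : ℕ) + 1 : ℤ) ^ 2 + d * ((j : ℕ) + 1 : ℤ) ^ 2) p)).det

open Finset Matrix

/-- The coefficient of `a ^ r` in `(a + u) ^ (2 * m + 5)` once exponents of `a` are reduced
modulo `m + 5`. -/
def foldedChoose (m r : ℕ) : ℕ :=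
  (2 * m + 5).choose r + (2 * m + 5).choose (r + (m + 5))

theorem foldedChoose_reflect {m r : ℕ} (hr : r ≤ m) :
    foldedChoose m (m - r) = foldedChoose m r := by
  unfold foldedChoose
  rw [add_comm, Nat.choose_symm_of_eq_add (n := 2 * m + 5) (a := m - r + (m + 5)) (b := r) (by lia),
    Nat.choose_symm_of_eq_add (n := 2 * m + 5) (a := m - r) (b := r + (m + 5)) (by lia)]

theorem foldedChoose_eq_choose {m r : ℕ} (hr : m < r) :
    foldedChoose m r = (2 * m + 5).choose r := by
  rw [foldedChoose, Nat.choose_eq_zero_of_lt (n := 2 * m + 5) (k := r + (m + 5)) (by lia), add_zero]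

theorem foldedChoose_two_mul (k : ℕ) :
    foldedChoose (2 * k) k = 2 * (4 * k + 5).choose k := by
  unfold foldedChoose
  rw [Nat.choose_symm_of_eq_add (n := 2 * (2 * k) + 5) (a := k + (2 * k + 5)) (b := k) (by lia),
    ← two_mul, show 2 * (2 * k) + 5 = 4 * k + 5 by ring]

theorem add_pow_eq_sum_foldedChoose {R : Type*} [CommRing R] (m : ℕ) {a u : R}
    (ha : a ^ (m + 5) = 1) (hu : u ^ (m + 5) = 1) :
    (a + u) ^ (2 * m + 5) =
      ∑ r ∈ range (m + 5), u ^ (m + 1) * (a ^ r * foldedChoose m r * u ^ (m + 4 - r)) := by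
  have split : ∀ r, u ^ (m + 1) * (a ^ r * foldedChoose m r * u ^ (m + 4 - r)) =
      u ^ (m + 1) * (a ^ r * (2 * m + 5).choose r * u ^ (m + 4 - r)) +
      u ^ (m + 1) * (a ^ r * (2 * m + 5).choose (r + (m + 5)) * u ^ (m + 4 - r)) := by
    intro r
    simp only [foldedChoose, Nat.cast_add]
    ring
  rw [add_pow, show 2 * m + 5 + 1 = (m + 5) + (m + 1) by ring, sum_range_add]
  simp_rw [split]
  rw [sum_add_distrib]
  congr 1
  · refine sum_congr rfl fun r hr => ?_
    have hr := mem_range.1 hr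
    rw [show 2 * m + 5 - r = (m + 1) + (m + 4 - r) by lia, pow_add]
    ring
  · rw [show range (m + 5) = range ((m + 1) + 4) from rfl, sum_range_add _ (m + 1) 4]
    rw [sum_eq_zero (s := range 4), add_zero]
    · refine sum_congr rfl fun r hr => ?_
      have hr := mem_range.1 hr
      have e : u ^ (m + 1) * u ^ (m + 4 - r) = u ^ (2 * m + 5 - (m + 5 + r)) := by
        rw [← pow_add, show m + 1 + (m + 4 - r) = (m + 5) + (2 * m + 5 - (m + 5 + r)) by lia,
          pow_add, hu, one_mul]
      rw [← e, pow_add, ha, add_comm r (m + 5)]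
      ring
    · intro r _
      rw [Nat.choose_eq_zero_of_lt (by lia)]
      simp

theorem det_projVandermonde_one_left {R : Type*} [CommRing R] {n : ℕ} (a : Fin n → R) :
    (projVandermonde 1 a).det = (-1) ^ n.choose 2 * (vandermonde a).det := by
  have hcard : ∑ i : Fin n, #(Ioi i) = n.choose 2 := by
    simp only [Fin.card_Ioi]
    rw [Fin.sum_univ_eq_sum_range (fun i => n - 1 - i), sum_range_reflect (fun i => i),
      sum_range_id, Nat.choose_two_right]
  rw [det_projVandermonde, det_vandermonde, ← hcard, ← prod_pow_eq_pow_sum, ← prod_mul_distrib]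
  refine prod_congr rfl fun i _ => ?_
  rw [← prod_const, ← prod_mul_distrib]
  refine prod_congr rfl fun j _ => ?_
  simp

/-- Evaluation of the determinant of a power of a sum, over `(m + 5)`-th roots of unity. -/
theorem det_add_pow {R : Type*} [CommRing R] (m : ℕ) (a u : Fin (m + 5) → R)
    (ha : ∀ i, a i ^ (m + 5) = 1) (hu : ∀ i, u i ^ (m + 5) = 1) :
    (of fun i j => (a i + u j) ^ (2 * m + 5)).det =
      (∏ j, u j ^ (m + 1)) * ((vandermonde a).det * (∏ r ∈ range (m + 5), (foldedChoose m r : R)) *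
        (projVandermonde 1 u).det) := by
  have key : (of fun i j => (a i + u j) ^ (2 * m + 5)) =
      of fun i j => u j ^ (m + 1) *
        (vandermonde a * diagonal (fun r : Fin (m + 5) => (foldedChoose m r : R)) *
          (projVandermonde 1 u)ᵀ) i j := by
    ext i j
    rw [of_apply, of_apply, add_pow_eq_sum_foldedChoose m (ha i) (hu j), ← mul_sum, mul_apply,
      ← Fin.sum_univ_eq_sum_range (fun r => a i ^ r * (foldedChoose m r : R) * u j ^ (m + 4 - r))]
    congr 1
    refine sum_congr rfl fun r _ => ?_
    rw [mul_diagonal, vandermonde_apply, transpose_apply, projVandermonde_apply, Fin.val_rev,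
      Pi.one_apply, one_pow, one_mul, show m + 5 - (r + 1) = m + 4 - (r : ℕ) by lia]
  rw [key, det_mul_row, det_mul, det_mul, det_diagonal, det_transpose,
    ← Fin.prod_univ_eq_prod_range (fun r => (foldedChoose m r : R))]

theorem prod_range_two_mul_of_reflect {M : Type*} [CommMonoid M] (f : ℕ → M) (k : ℕ)
    (hf : ∀ i < k, f (2 * k - 1 - i) = f i) : IsSquare (∏ i ∈ range (2 * k), f i) := by
  rw [two_mul, prod_range_add]
  refine ⟨∏ i ∈ range k, f i, ?_⟩
  congr 1
  rw [← prod_range_reflect]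
  refine prod_congr rfl fun i hi => ?_
  have hi := mem_range.1 hi
  rw [← hf i hi]
  congr 1
  lia

theorem prod_range_two_mul_add_one_of_reflect {M : Type*} [CommMonoid M] (f : ℕ → M) (k : ℕ)
    (hf : ∀ i < k, f (2 * k - i) = f i) :
    ∃ s, IsSquare s ∧ ∏ i ∈ range (2 * k + 1), f i = f k * s := by
  refine ⟨(∏ i ∈ range k, f i) * ∏ i ∈ range k, f i, ⟨_, rfl⟩, ?_⟩
  rw [show 2 * k + 1 = k + 1 + k by ring, prod_range_add, prod_range_succ, mul_comm _ (f k),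
    mul_assoc]
  congr 2
  rw [← prod_range_reflect]
  refine prod_congr rfl fun i hi => ?_
  have hi := mem_range.1 hi
  rw [← hf i hi]
  congr 1
  lia

theorem prod_foldedChoose (m : ℕ) :
    ∃ s, IsSquare s ∧ ∏ r ∈ range (m + 5), foldedChoose m r =
      (∏ r ∈ range (m + 1), foldedChoose m r) * s := by
  refine ⟨∏ i ∈ range 4, foldedChoose m (m + 1 + i), ?_, ?_⟩
  · refine prod_range_two_mul_of_reflect _ 2 fun i hi => ?_
    rw [foldedChoose_eq_choose (by lia), foldedChoose_eq_choose (by lia)]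
    exact Nat.choose_symm_of_eq_add (by lia)
  · rw [show m + 5 = (m + 1) + 4 from rfl, prod_range_add]

theorem isSquare_prod_foldedChoose_of_odd (k : ℕ) :
    IsSquare (∏ r ∈ range (2 * k + 1 + 5), foldedChoose (2 * k + 1) r) := by
  obtain ⟨s, hs, h⟩ := prod_foldedChoose (2 * k + 1)
  rw [h]
  refine .mul (prod_range_two_mul_of_reflect _ (k + 1) fun i hi => ?_) hs
  rw [← foldedChoose_reflect (m := 2 * k + 1) (r := i) (by lia)]
  rfl

theorem prod_foldedChoose_of_even (k : ℕ) :
    ∃ s, IsSquare s ∧ ∏ r ∈ range (2 * k + 5), foldedChoose (2 * k) r =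
      2 * (4 * k + 5).choose k * s := by
  obtain ⟨s, hs, h⟩ := prod_foldedChoose (2 * k)
  obtain ⟨t, ht, h'⟩ := prod_range_two_mul_add_one_of_reflect (foldedChoose (2 * k)) k
    fun i hi => foldedChoose_reflect (by lia)
  exact ⟨t * s, ht.mul hs, by rw [h, h', foldedChoose_two_mul, mul_assoc]⟩

/-- Modulo a prime `p = N + 6`, `choose N k` is `choose (-6) k`. -/
theorem choose_prime_sub_six {p : ℕ} [Fact p.Prime] {N : ℕ} (hN : p = N + 6) {k : ℕ}
    (hk : k ≤ N) : (N.choose k : ZMod p) = (-1) ^ k * ((k + 5).choose 5 : ZMod p) := by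
  have hp0 : (N : ZMod p) + 6 = 0 := by
    have := ZMod.natCast_self p
    rw [congrArg (Nat.cast (R := ZMod p)) hN] at this
    exact_mod_cast this
  induction k with
  | zero => simp
  | succ k ih =>
    have hne : ((k + 1 : ℕ) : ZMod p) ≠ 0 := by
      rw [Ne, ZMod.natCast_eq_zero_iff]
      exact Nat.not_dvd_of_pos_of_lt (by lia) (by lia)
    have h1 : (N.choose (k + 1) : ZMod p) * ((k + 1 : ℕ) : ZMod p) =
        N.choose k * ((N : ZMod p) - k) := by
      rw [← Nat.cast_sub (by lia)]
      rw [← Nat.cast_mul, ← Nat.cast_mul, Nat.choose_succ_right_eq]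
    have h2 : ((k + 1 + 5).choose 5 : ZMod p) * ((k + 1 : ℕ) : ZMod p) =
        (k + 5).choose 5 * ((k : ZMod p) + 6) := by
      have := Nat.choose_mul_succ_eq (k + 5) 5
      rw [show k + 5 + 1 - 5 = k + 1 by lia] at this
      have := congrArg (Nat.cast (R := ZMod p)) this
      push_cast at this ⊢
      rw [show k + 1 + 5 = k + 5 + 1 by ring]
      linear_combination -this
    apply mul_right_cancel₀ hne
    rw [h1, ih (by lia), pow_succ]
    linear_combination (-1) ^ k * h2 + (-1) ^ k * ((k + 5).choose 5 : ZMod p) * hp0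

theorem cast_choose_five {R : Type*} [CommRing R] (k : ℕ) :
    ((k + 5).choose 5 : R) * 120 = (k + 1) * (k + 2) * (k + 3) * (k + 4) * (k + 5) := by
  have := Nat.ascFactorial_eq_factorial_mul_choose k 5
  simp only [Nat.ascFactorial, Nat.factorial] at this
  have := congrArg (Nat.cast (R := R)) this
  push_cast at this
  linear_combination -this

theorem isSquare_seven_mul_choose {p k : ℕ} [Fact p.Prime] (hp : p = 4 * k + 11) :
    IsSquare (7 * ((-1) ^ k * (2 * (4 * k + 5).choose k)) : ZMod p) := by
  have ndvd : ∀ q : ℕ, q.Prime → q < 11 → (q : ZMod p) ≠ 0 := by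
    intro q hq hlt
    rw [Ne, ZMod.natCast_eq_zero_iff]
    exact Nat.not_dvd_of_pos_of_lt hq.pos (by lia)
  have h2 : (2 : ZMod p) ≠ 0 := mod_cast ndvd 2 Nat.prime_two (by simp)
  have h3 : (3 : ZMod p) ≠ 0 := mod_cast ndvd 3 Nat.prime_three (by simp)
  have h5 : (5 : ZMod p) ≠ 0 := mod_cast ndvd 5 Nat.prime_five (by simp)
  have h4 : (4 : ZMod p) ≠ 0 := by
    rw [show (4 : ZMod p) = 2 * 2 by norm_num]
    exact mul_ne_zero h2 h2
  have h64 : (64 : ZMod p) ≠ 0 := by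
    rw [show (64 : ZMod p) = 2 ^ 6 by norm_num]
    exact pow_ne_zero _ h2
  have h120 : (120 : ZMod p) ≠ 0 := by
    rw [show (120 : ZMod p) = 2 ^ 3 * 3 * 5 by norm_num]
    exact mul_ne_zero (mul_ne_zero (pow_ne_zero _ h2) h3) h5
  have hk : (k : ZMod p) = -11 / 4 := by
    rw [eq_div_iff h4]
    have := ZMod.natCast_self p
    rw [congrArg (Nat.cast (R := ZMod p)) hp] at this
    push_cast at this
    linear_combination this
  have hc : ((k + 5).choose 5 : ZMod p) * 120 = 945 / 1024 := by
    rw [cast_choose_five, hk, eq_div_iff (by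
      rw [show (1024 : ZMod p) = 4 ^ 5 by norm_num]
      exact pow_ne_zero _ h4)]
    field_simp
    norm_num
  have hc' : ((k + 5).choose 5 : ZMod p) = 63 / (2 * 64 * 64) := by
    apply mul_right_cancel₀ h120
    rw [hc, div_mul_eq_mul_div, div_eq_div_iff]
    · norm_num
    · rw [show (1024 : ZMod p) = 2 ^ 10 by norm_num]
      exact pow_ne_zero _ h2
    · exact mul_ne_zero (mul_ne_zero h2 h64) h64
  refine ⟨21 / 64, ?_⟩
  rw [choose_prime_sub_six (N := 4 * k + 5) (by lia) (by lia), hc',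
    show (7 * ((-1) ^ k * (2 * ((-1) ^ k * (63 / (2 * 64 * 64))))) : ZMod p) =
      ((-1) ^ k * (-1) ^ k) * (7 * (2 * (63 / (2 * 64 * 64)))) by ring,
    ← mul_pow, neg_one_mul, neg_neg, one_pow, one_mul]
  field_simp
  norm_num

/-- `Tdet d p ((p - 11) / 2)` modulo `p`, up to a square. -/
theorem cast_Tdet_eq {p m : ℕ} [Fact p.Prime] (hp : p = 2 * m + 11) {d : ℤ}
    (hd : jacobiSym d p = 1) :
    ∃ s : ZMod p, IsSquare s ∧ (Tdet d p m : ZMod p) =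
      s * ((-1) ^ (m + 5).choose 2 * ∏ r ∈ range (m + 5), (foldedChoose m r : ZMod p)) := by
  have hdet : (Tdet d p m : ZMod p) = (of fun i j : Fin ((p - 1) / 2) =>
      ((((i : ℕ) : ZMod p) + 1) ^ 2 + d * (((j : ℕ) : ZMod p) + 1) ^ 2) ^ (2 * m + 5)).det := by
    rw [Tdet, ← eq_intCast (Int.castRingHom (ZMod p)), RingHom.map_det]
    congr 1
    ext i j
    simp only [RingHom.mapMatrix_apply, map_apply, of_apply, Int.coe_castRingHom]
    rw [← jacobiSym.legendreSym.to_jacobiSym, Int.cast_mul, legendreSym.eq_pow]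
    push_cast
    rw [← pow_add]
    congr 1
    lia
  have hn : (p - 1) / 2 = m + 5 := by lia
  rw [hn] at hdet
  rw [← jacobiSym.legendreSym.to_jacobiSym] at hd
  have hd0 : (d : ZMod p) ≠ 0 := by
    intro h
    rw [← legendreSym.eq_zero_iff] at h
    lia
  obtain ⟨c, hc⟩ := (legendreSym.eq_one_iff p hd0).1 hd
  have hc0 : c ≠ 0 := by
    rintro rfl
    exact hd0 (by rw [hc, mul_zero])
  have hsq : ∀ x : ZMod p, x ≠ 0 → (x ^ 2) ^ (m + 5) = 1 := by
    intro x hx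
    rw [← pow_mul, show 2 * (m + 5) = p - 1 by lia]
    exact ZMod.pow_card_sub_one_eq_one hx
  have hi : ∀ i : Fin (m + 5), (((i : ℕ) : ZMod p) + 1) ≠ 0 := by
    intro i
    rw [← Nat.cast_add_one, Ne, ZMod.natCast_eq_zero_iff]
    exact Nat.not_dvd_of_pos_of_lt (by lia) (by lia)
  set a : Fin (m + 5) → ZMod p := fun i => (((i : ℕ) : ZMod p) + 1) ^ 2 with ha
  have hu : ∀ i : Fin (m + 5), ((d : ZMod p) * a i) = (c * (((i : ℕ) : ZMod p) + 1)) ^ 2 := by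
    intro i
    rw [hc, ha]
    ring
  have hproj : (projVandermonde 1 fun j => (d : ZMod p) * a j).det =
      (∏ r : Fin (m + 5), (d : ZMod p) ^ (r.rev : ℕ)) * (projVandermonde 1 a).det := by
    rw [← det_mul_row]
    congr 1
    ext i r
    simp [projVandermonde_apply, mul_pow]
  rw [hdet, det_add_pow m a (fun j => d * a j) (fun i => hsq _ (hi i))
    (fun i => by rw [hu]; exact hsq _ (mul_ne_zero hc0 (hi i))), hproj,
    det_projVandermonde_one_left]
  refine ⟨(∏ j, ((d : ZMod p) * a j) ^ (m + 1)) * (∏ r : Fin (m + 5), (d : ZMod p) ^ (r.rev : ℕ)) *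
    ((vandermonde a).det * (vandermonde a).det), ?_, by ring⟩
  refine .mul (.mul ?_ ?_) ⟨_, rfl⟩
  · exact Finset.isSquare_prod _ fun j _ => by
      rw [hu]
      exact (IsSquare.sq _).pow _
  · exact Finset.isSquare_prod _ fun r _ => by
      rw [hc]
      exact IsSquare.pow _ ⟨_, rfl⟩

theorem mod_seven_of_isSquare :
    ∀ r < 7, r ≠ 0 → IsSquare ((r : ℕ) : ZMod 7) → r = 1 ∨ r = 2 ∨ r = 4 := by
  decide

/-- Let `p > 7` be a prime and `d` an integer with `(d/p) = 1`.
If `(T_{(p−11)/2}(d,p)/p) = −1`, then `p ≡ 1, 2` or `4 (mod 7)`. -/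
theorem stmt5 (p : ℕ) (hp : p.Prime) (hp7 : 7 < p) (d : ℤ) (hd : jacobiSym d p = 1)
    (h : jacobiSym (Tdet d p ((p - 11) / 2)) p = -1) :
    p % 7 = 1 ∨ p % 7 = 2 ∨ p % 7 = 4 := by
  have : Fact p.Prime := ⟨hp⟩
  have hodd : p % 2 = 1 := hp.eq_two_or_odd.resolve_left (by lia)
  have hp9 : p ≠ 9 := by
    rintro rfl
    norm_num at hp
  obtain ⟨m, hm⟩ : ∃ m, p = 2 * m + 11 := ⟨(p - 11) / 2, by lia⟩
  rw [show (p - 11) / 2 = m by lia, ← jacobiSym.legendreSym.to_jacobiSym,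
    legendreSym.eq_neg_one_iff] at h
  obtain ⟨s, hs, hT⟩ := cast_Tdet_eq hm hd
  rcases Nat.even_or_odd' m with ⟨k, rfl | rfl⟩
  · obtain ⟨t, ht, hprod⟩ := prod_foldedChoose_of_even k
    have h7 : ¬ IsSquare ((7 : ℕ) : ZMod p) := by
      intro h7
      apply h
      have h70 : ((7 : ℕ) : ZMod p) ≠ 0 := by
        rw [Ne, ZMod.natCast_eq_zero_iff]
        exact Nat.not_dvd_of_pos_of_lt (by lia) hp7
      have hsign : (-1 : ZMod p) ^ (2 * k + 5).choose 2 = (-1) ^ k := by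
        rw [Nat.choose_two_right, show (2 * k + 5) * (2 * k + 5 - 1) / 2 =
          2 * (k ^ 2 + 4 * k + 5) + k by
            apply Nat.div_eq_of_eq_mul_left two_pos
            rw [show 2 * k + 5 - 1 = 2 * k + 4 by lia]
            ring, pow_add, pow_mul]
        simp
      have hsq := (hs.mul (ht.map (Nat.castRingHom (ZMod p)))).mul
        (isSquare_seven_mul_choose (p := p) (k := k) (by lia))
      have := hsq.mul (h7.inv)
      rwa [hT, hsign, ← Nat.cast_prod, hprod,
        show s * ((-1) ^ k * ((2 * (4 * k + 5).choose k * t : ℕ) : ZMod p)) =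
          s * Nat.castRingHom (ZMod p) t * (7 * ((-1) ^ k * (2 * (4 * k + 5).choose k))) *
            ((7 : ℕ) : ZMod p)⁻¹ by
          rw [eq_mul_inv_iff_mul_eq₀ h70]
          push_cast
          ring]
    have : Fact (Nat.Prime 7) := ⟨by norm_num⟩
    have hq : IsSquare ((p : ℕ) : ZMod 7) := by
      by_contra hcon
      exact h7 ((ZMod.exists_sq_eq_prime_iff_of_mod_four_eq_three (p := p) (q := 7)
        (by lia) (by norm_num) (by lia)).2 hcon)
    have hp7' : p % 7 ≠ 0 := fun h0 => by
      have := (Nat.prime_dvd_prime_iff_eq (by norm_num) hp).1 (Nat.dvd_of_mod_eq_zero h0)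
      lia
    rw [← ZMod.natCast_mod] at hq
    exact mod_seven_of_isSquare _ (Nat.mod_lt p (by norm_num)) hp7' hq
  · refine (h ?_).elim
    have hneg : IsSquare (-1 : ZMod p) := ZMod.exists_sq_eq_neg_one_iff.2 (by lia)
    rw [hT, ← Nat.cast_prod]
    exact hs.mul ((hneg.pow _).mul
      ((isSquare_prod_foldedChoose_of_odd k).map (Nat.castRingHom (ZMod p))))
end

section
/- For every positive odd integer m, the set E(m) = {p : p is a prime with p ≡ 1 (mod 4) and p | D_p^(m)} is finite. -/
/-- The matrix `[(i² − j²)^m · ((i² − j²)/p)]_{1 ≤ i,j ≤ (p−1)/2}` over `ℤ`, where the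
Legendre symbol is expressed via the Jacobi symbol (they agree for odd primes `p`). -/
def Dmat (p m : ℕ) : Matrix (Fin ((p - 1) / 2)) (Fin ((p - 1) / 2)) ℤ :=
  Matrix.of (fun i j =>
    (((i : ℕ) + 1 : ℤ) ^ 2 - ((j : ℕ) + 1 : ℤ) ^ 2) ^ m *
      jacobiSym ((((i : ℕ) + 1 : ℤ) ^ 2 - ((j : ℕ) + 1 : ℤ) ^ 2)) p)

/-- `D_p^(m) = det[(i² − j²)^m · ((i² − j²)/p)]_{1 ≤ i,j ≤ (p−1)/2}`. -/
def Dp (p m : ℕ) : ℤ := (Dmat p m).det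

/-- `E(m)` is the set of primes `p ≡ 1 (mod 4)` with `p ∣ D_p^(m)`. -/
def Eset (m : ℕ) : Set ℕ := {p : ℕ | p.Prime ∧ p % 4 = 1 ∧ (p : ℤ) ∣ Dp p m}

/-- Modulo `p = 2 * n + 1`, the number `2 ^ r * r! * (n + m).choose r` is the product of the odd
numbers `2 * m - 1 - 2 * i` for `i < r`. -/
theorem two_pow_mul_factorial_mul_choose_cast {p n m r : ℕ} (hp : p = 2 * n + 1) (hr : r ≤ m) :
    ((2 ^ r * r.factorial * (n + m).choose r : ℕ) : ZMod p) =
      ((∏ i ∈ Finset.range r, (2 * m - 1 - 2 * i) : ℕ) : ZMod p) := by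
  rw [mul_assoc, ← Nat.descFactorial_eq_factorial_mul_choose, Nat.descFactorial_eq_prod_range,
    ← Finset.card_range r, ← Finset.prod_const, Finset.card_range, ← Finset.prod_mul_distrib,
    Nat.cast_prod, Nat.cast_prod]
  refine Finset.prod_congr rfl fun i hi => ?_
  have hi := Finset.mem_range.1 hi
  rw [show 2 * (n + m - i) = p + (2 * m - 1 - 2 * i) by omega]
  simp

/-- A positive integer that `p` must divide whenever
`p ∣ (n + m).choose r + (n + m).choose (m - r)` and `p = 2 * n + 1`. -/
def chooseObstruction (m r : ℕ) : ℕ :=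
  2 ^ (m - r) * (m - r).factorial * ∏ i ∈ Finset.range r, (2 * m - 1 - 2 * i) +
    2 ^ r * r.factorial * ∏ i ∈ Finset.range (m - r), (2 * m - 1 - 2 * i)

theorem chooseObstruction_pos {m r : ℕ} (hr : r ≤ m) : 0 < chooseObstruction m r := by
  have h : 0 < ∏ i ∈ Finset.range r, (2 * m - 1 - 2 * i) :=
    Finset.prod_pos fun i hi => by
      have := Finset.mem_range.1 hi
      omega
  have := (m - r).factorial_pos
  unfold chooseObstruction
  positivity

theorem chooseObstruction_cast {p n m r : ℕ} (hp : p = 2 * n + 1) (hr : r ≤ m) :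
    (chooseObstruction m r : ZMod p) = ((2 ^ m * r.factorial * (m - r).factorial : ℕ) : ZMod p) *
      ((n + m).choose r + (n + m).choose (n + r) : ℕ) := by
  have h₁ := two_pow_mul_factorial_mul_choose_cast hp hr
  have h₂ := two_pow_mul_factorial_mul_choose_cast hp (Nat.sub_le m r)
  have h₃ : (n + m).choose (n + r) = (n + m).choose (m - r) := by
    rw [← Nat.choose_symm (by omega : n + r ≤ n + m)]
    congr 1
    omega
  have h₄ : 2 ^ m = 2 ^ r * 2 ^ (m - r) := by rw [← pow_add, Nat.add_sub_cancel' hr]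
  rw [chooseObstruction, h₃, h₄, Nat.cast_add, Nat.cast_mul, Nat.cast_mul (2 ^ r * r.factorial), ← h₁,
    ← h₂]
  push_cast
  ring

theorem choose_add_choose_cast_ne_zero {p n m k : ℕ} [Fact p.Prime] (hp : p = 2 * n + 1)
    (hmn : m < n) (hk : k < n) (hA : ∀ r ≤ m, chooseObstruction m r < p) :
    ((n + m).choose k + (n + m).choose (n + k) : ZMod p) ≠ 0 := by
  intro h
  rcases le_or_gt k m with hkm | hkm
  · have h₁ := chooseObstruction_cast hp hkm
    rw [Nat.cast_add, h, mul_zero, ZMod.natCast_eq_zero_iff] at h₁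
    exact absurd (Nat.le_of_dvd (chooseObstruction_pos hkm) h₁) (not_le.2 (hA k hkm))
  · rw [Nat.choose_eq_zero_of_lt (by omega : n + m < n + k), Nat.cast_zero, add_zero,
      ZMod.natCast_eq_zero_iff] at h
    have h₁ : p ∣ (n + m).factorial := by
      rw [← Nat.choose_mul_factorial_mul_factorial (by omega : k ≤ n + m), mul_assoc]
      exact h.mul_right _
    have := (Fact.out : p.Prime).dvd_factorial.1 h₁
    omega

/-- Folding of the binomial expansion of `(w + 1) ^ (n + m)` when `w ^ n = 1`. -/
theorem add_one_pow_of_pow_eq_one {R : Type*} [CommRing R] {n m : ℕ} (hmn : m < n) {w : R}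
    (hw : w ^ n = 1) :
    (w + 1) ^ (n + m) =
      ∑ k : Fin n, w ^ (k : ℕ) * ((n + m).choose k + (n + m).choose (n + k) : R) := by
  have h₁ : (w + 1) ^ (n + m) = ∑ k ∈ Finset.range (n + n), w ^ k * ((n + m).choose k : R) := by
    rw [add_pow]
    simp only [one_pow, mul_one]
    refine Finset.sum_subset (Finset.range_subset_range.2 (by omega)) fun k _ hk => ?_
    rw [Nat.choose_eq_zero_of_lt (by simpa using hk), Nat.cast_zero, mul_zero]
  rw [h₁, Finset.sum_range_add, ← Finset.sum_add_distrib, ← Fin.sum_univ_eq_sum_range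
    (fun k => w ^ k * ((n + m).choose k : R) + w ^ (n + k) * ((n + m).choose (n + k) : R))]
  refine Finset.sum_congr rfl fun k _ => ?_
  rw [pow_add, hw]
  ring

/-- Over a field, the determinant of `(x i - x j) ^ (n + m)` for distinct `n`-th roots of
unity `x i` is nonzero as soon as the folded binomial coefficients are. -/
theorem det_sub_pow_ne_zero {K : Type*} [Field K] {n m : ℕ} (hmn : m < n) (hn : Even n)
    {x : Fin n → K} (hx : Function.Injective x) (hxn : ∀ i, x i ^ n = 1)
    (hc : ∀ k < n, ((n + m).choose k + (n + m).choose (n + k) : K) ≠ 0) :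
    (Matrix.of fun i j => (x i - x j) ^ (n + m)).det ≠ 0 := by
  have hx0 : ∀ i, x i ≠ 0 := fun i h => by
    have := hxn i
    rw [h, zero_pow (by omega)] at this
    exact zero_ne_one this
  have hM : (Matrix.of fun i j => (x i - x j) ^ (n + m)) =
      Matrix.vandermonde x *
        Matrix.diagonal (fun k : Fin n => ((n + m).choose k + (n + m).choose (n + k) : K)) *
        (Matrix.vandermonde fun j => (-x j)⁻¹).transpose *
        Matrix.diagonal fun j => (-x j) ^ (n + m) := by
    ext i j
    have hw : (x i * (-x j)⁻¹) ^ n = 1 := by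
      rw [mul_pow, inv_pow, hn.neg_pow, hxn, hxn, inv_one, mul_one]
    have hsub : x i - x j = (x i * (-x j)⁻¹ + 1) * -x j := by
      have := neg_ne_zero.2 (hx0 j)
      rw [add_mul, inv_mul_cancel_right₀ this]
      ring
    rw [Matrix.of_apply, hsub, mul_pow, add_one_pow_of_pow_eq_one hmn hw, Matrix.mul_diagonal,
      Matrix.mul_apply]
    congr 1
    refine Finset.sum_congr rfl fun k _ => ?_
    rw [Matrix.mul_diagonal, Matrix.transpose_apply, Matrix.vandermonde_apply,
      Matrix.vandermonde_apply, mul_pow]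
    ring
  rw [hM]
  simp only [Matrix.det_mul, Matrix.det_transpose, Matrix.det_diagonal]
  refine mul_ne_zero (mul_ne_zero (mul_ne_zero ?_ ?_) ?_) ?_
  · exact Matrix.det_vandermonde_ne_zero_iff.2 hx
  · exact Finset.prod_ne_zero_iff.2 fun k _ => hc k k.2
  · exact Matrix.det_vandermonde_ne_zero_iff.2 fun i j h => hx (neg_injective (inv_injective h))
  · exact Finset.prod_ne_zero_iff.2 fun k _ => pow_ne_zero _ (neg_ne_zero.2 (hx0 k))

theorem injective_sq_succ_zmod {p : ℕ} [Fact p.Prime] (hp : p % 2 = 1) :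
    Function.Injective fun i : Fin ((p - 1) / 2) => (((i : ℕ) + 1 : ZMod p)) ^ 2 := by
  intro i j h
  have hi := i.2
  have hj := j.2
  rcases sq_eq_sq_iff_eq_or_eq_neg.1 h with h | h
  · have h : (((i : ℕ) + 1 : ℕ) : ZMod p) = ((j : ℕ) + 1 : ℕ) := by exact_mod_cast h
    rw [ZMod.natCast_eq_natCast_iff', Nat.mod_eq_of_lt (by omega), Nat.mod_eq_of_lt (by omega)] at h
    exact Fin.ext (by omega)
  · have h : (((i : ℕ) + 1 + ((j : ℕ) + 1) : ℕ) : ZMod p) = 0 := by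
      push_cast
      rw [h]
      ring
    rw [ZMod.natCast_eq_zero_iff] at h
    have := Nat.le_of_dvd (by omega) h
    omega

theorem Dp_cast {p m : ℕ} [Fact p.Prime] (hp : p % 2 = 1) :
    (Dp p m : ZMod p) = (Matrix.of fun i j : Fin ((p - 1) / 2) =>
      (((i : ℕ) + 1 : ZMod p) ^ 2 - ((j : ℕ) + 1 : ZMod p) ^ 2) ^ ((p - 1) / 2 + m)).det := by
  rw [Dp, Int.cast_det]
  congr 1
  ext i j
  rw [Matrix.map_apply, Dmat, Matrix.of_apply, Matrix.of_apply, Int.cast_mul,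
    ← jacobiSym.legendreSym.to_jacobiSym, legendreSym.eq_pow, pow_add,
    show p / 2 = (p - 1) / 2 by omega]
  push_cast
  exact mul_comm _ _

/-- For every positive odd integer `m`, the set
`E(m) = {p : p prime, p ≡ 1 (mod 4), p ∣ D_p^(m)}` is finite. -/
theorem stmt6 (m : ℕ) (hm : Odd m) (hm0 : 0 < m) : (Eset m).Finite := by
  refine (Set.finite_Iic
    (2 * m + 2 + ∑ r ∈ Finset.range (m + 1), chooseObstruction m r)).subset ?_
  rintro p ⟨hp, hp4, hdvd⟩
  by_contra hlt
  rw [Set.mem_Iic, not_le] at hlt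
  have : Fact p.Prime := ⟨hp⟩
  have hA : ∀ r ≤ m, chooseObstruction m r < p := fun r hr => by
    have := Finset.single_le_sum (f := chooseObstruction m) (fun _ _ => Nat.zero_le _)
      (Finset.mem_range.2 (Nat.lt_add_one_of_le hr))
    omega
  rw [← ZMod.intCast_zmod_eq_zero_iff_dvd, Dp_cast (by omega)] at hdvd
  refine det_sub_pow_ne_zero (by omega) (Nat.even_iff.2 (by omega))
    (injective_sq_succ_zmod (by omega)) (fun i => ?_)
    (fun k hk => choose_add_choose_cast_ne_zero (by omega) (by omega) hk hA) hdvd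
  have hi := i.2
  have h0 : ((i : ℕ) + 1 : ZMod p) ≠ 0 := fun h => by
    have h : (((i : ℕ) + 1 : ℕ) : ZMod p) = 0 := by exact_mod_cast h
    have := Nat.le_of_dvd (by omega) ((ZMod.natCast_eq_zero_iff _ _).1 h)
    omega
  rw [← pow_mul, show 2 * ((p - 1) / 2) = p - 1 by omega]
  exact ZMod.pow_card_sub_one_eq_one h0
end

section
/- E(5) = {29}; that is, the only prime p with p ≡ 1 (mod 4) and p | D_p^(5) is p = 29. -/
/-- A generalized binomial expansion modulo `x ^ n = 1`, `y ^ n = 1`. -/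
theorem sub_pow_add_eq_sum_of_pow_eq_one {R : Type*} [CommRing R] {n m : ℕ} (hmn : m < n)
    (hn : Even n) {x y : R} (hx : x ^ n = 1) (hy : y ^ n = 1) :
    (x - y) ^ (m + n) = ∑ k ∈ Finset.range n,
      (-1) ^ (m + n - k) * (((m + n).choose k + (m + n).choose (n + k) : ℕ) : R) *
        (x ^ k * y ^ (m + n - k)) := by
  have hterm : ∀ r, x ^ r * (-y) ^ (m + n - r) * ((m + n).choose r : R)
      = (-1) ^ (m + n - r) * ((m + n).choose r : R) * (x ^ r * y ^ (m + n - r)) := by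
    intro r
    rw [neg_pow y]
    ring
  have hvanish : ∑ r ∈ Finset.range (n + n), x ^ r * (-y) ^ (m + n - r) * ((m + n).choose r : R)
      = ∑ r ∈ Finset.range (m + n + 1), x ^ r * (-y) ^ (m + n - r) * ((m + n).choose r : R) := by
    refine (Finset.sum_subset (Finset.range_subset_range.2 (by omega)) fun r _ hr => ?_).symm
    rw [Nat.choose_eq_zero_of_lt (by rw [Finset.mem_range] at hr; omega)]
    simp
  rw [sub_eq_add_neg, add_pow, ← hvanish, Finset.sum_range_add, ← Finset.sum_add_distrib]
  refine Finset.sum_congr rfl fun k _ => ?_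
  rw [hterm, hterm]
  by_cases hk : k ≤ m
  · have h1 : m + n - (n + k) = m - k := by omega
    have h2 : m + n - k = (m - k) + n := by omega
    rw [h1, h2, pow_add, pow_add, pow_add, hx, hy, hn.neg_one_pow]
    push_cast
    ring
  · rw [Nat.choose_eq_zero_of_lt (show m + n < n + k by omega)]
    simp

/-- The kernel `(x - y) ^ (m + n)` on distinct `n`-th roots of unity has nonzero determinant exactly
when all coefficients of its expansion are nonzero. -/
theorem det_sub_pow_add_ne_zero_iff {K : Type*} [Field K] {n m : ℕ} (hmn : m < n) (hn : Even n)
    {x : Fin n → K} (hx : ∀ i, x i ^ n = 1) (hinj : Function.Injective x) :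
    (Matrix.of fun i j => (x i - x j) ^ (m + n)).det ≠ 0 ↔
      ∀ k < n, (((m + n).choose k + (m + n).choose (n + k) : ℕ) : K) ≠ 0 := by
  have hx0 : ∀ i, x i ≠ 0 := fun i h => by
    have := hx i
    rw [h, zero_pow (by omega)] at this
    exact zero_ne_one this
  set c : Fin n → K := fun k => (-1) ^ (m + n - (k : ℕ)) *
    (((m + n).choose k + (m + n).choose (n + k) : ℕ) : K) with hc
  have hfactor : (Matrix.of fun i j => (x i - x j) ^ (m + n)) =
      Matrix.vandermonde x * Matrix.diagonal c *
        (Matrix.vandermonde fun i => (x i)⁻¹).transpose *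
        Matrix.diagonal (fun j => x j ^ (m + n)) := by
    ext i j
    rw [Matrix.mul_diagonal, Matrix.mul_apply, Matrix.of_apply,
      sub_pow_add_eq_sum_of_pow_eq_one hmn hn (hx i) (hx j), Finset.sum_range, Finset.sum_mul]
    refine Finset.sum_congr rfl fun k _ => ?_
    rw [Matrix.mul_diagonal, Matrix.transpose_apply, Matrix.vandermonde_apply,
      Matrix.vandermonde_apply, pow_sub₀ _ (hx0 j) (by omega), inv_pow]
    simp only [hc]
    ring
  rw [hfactor, Matrix.det_mul, Matrix.det_mul, Matrix.det_mul, Matrix.det_transpose,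
    Matrix.det_diagonal, Matrix.det_diagonal]
  have hV : (Matrix.vandermonde x).det ≠ 0 := Matrix.det_vandermonde_ne_zero_iff.2 hinj
  have hW : (Matrix.vandermonde fun i => (x i)⁻¹).det ≠ 0 :=
    Matrix.det_vandermonde_ne_zero_iff.2 (inv_injective.comp hinj)
  have hP : ∏ j, x j ^ (m + n) ≠ 0 := Finset.prod_ne_zero_iff.2 fun j _ => pow_ne_zero _ (hx0 j)
  rw [mul_ne_zero_iff, mul_ne_zero_iff, mul_ne_zero_iff, Finset.prod_ne_zero_iff]
  simp only [hc, mul_ne_zero_iff, Finset.mem_univ, true_imp_iff]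
  constructor
  · intro h k hk
    exact (h.1.1.2 ⟨k, hk⟩).2
  · intro h
    exact ⟨⟨⟨hV, fun k => ⟨pow_ne_zero _ (neg_ne_zero.2 one_ne_zero), h k k.2⟩⟩, hW⟩, hP⟩

/-- For `m < (p - 1) / 2`, the divisibility `p ∣ D_p^(m)` is a condition on binomial
coefficients. -/
theorem dvd_Dp_iff {p m : ℕ} (hp : p.Prime) (hp4 : p % 4 = 1) (hm : m < (p - 1) / 2) :
    (p : ℤ) ∣ Dp p m ↔ ∃ k < (p - 1) / 2,
      p ∣ (m + (p - 1) / 2).choose k + (m + (p - 1) / 2).choose ((p - 1) / 2 + k) := by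
  have : Fact p.Prime := ⟨hp⟩
  set n := (p - 1) / 2 with hn
  have hpn : p = 2 * n + 1 := by omega
  let x : Fin n → ZMod p := fun i => (((i : ℕ) + 1 : ℕ) : ZMod p) ^ 2
  have hx : ∀ i, x i ^ n = 1 := fun i => by
    have h0 : (((i : ℕ) + 1 : ℕ) : ZMod p) ≠ 0 := fun h => by
      have := Nat.le_of_dvd (by omega) ((ZMod.natCast_eq_zero_iff _ _).1 h)
      omega
    have h2 : 2 * n = p - 1 := by omega
    simp only [x]
    rw [← pow_mul, h2, ZMod.pow_card_sub_one_eq_one h0]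
  have hinj : Function.Injective x := fun i j h => by
    rcases sq_eq_sq_iff_eq_or_eq_neg.1 h with h | h
    · rw [ZMod.natCast_eq_natCast_iff', Nat.mod_eq_of_lt (by omega),
        Nat.mod_eq_of_lt (by omega)] at h
      exact Fin.ext (by omega)
    · rw [← add_eq_zero_iff_eq_neg, ← Nat.cast_add, ZMod.natCast_eq_zero_iff] at h
      have := Nat.le_of_dvd (by omega) h
      omega
  have hdet : ((Dp p m : ℤ) : ZMod p) = (Matrix.of fun i j => (x i - x j) ^ (m + n)).det := by
    have hmap := (Int.castRingHom (ZMod p)).map_det (Dmat p m)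
    rw [eq_intCast] at hmap
    rw [Dp, hmap]
    congr 1
    ext i j
    have h2 : p / 2 = n := by omega
    simp only [RingHom.mapMatrix_apply, Matrix.map_apply, Dmat, Matrix.of_apply, eq_intCast,
      Int.cast_mul, ← jacobiSym.legendreSym.to_jacobiSym, legendreSym.eq_pow, h2, x]
    push_cast
    rw [pow_add]
  have key := det_sub_pow_add_ne_zero_iff hm (show Even n from ⟨n / 2, by omega⟩) hx hinj
  rw [← ZMod.intCast_zmod_eq_zero_iff_dvd, hdet, ← not_iff_not, ← ne_eq, key]
  push Not
  simp only [ne_eq, ZMod.natCast_eq_zero_iff]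

/-- If `p = 2 * n + 1` is a prime, `n > 5`, and `p` divides a folded binomial coefficient of
`5 + n`, then `p` is one of finitely many primes. -/
theorem dvd_of_dvd_choose_add_choose {p n k : ℕ} (hp : p.Prime) (hpn : p = 2 * n + 1) (hn : 5 < n)
    (hk : k < n) (h : p ∣ (5 + n).choose k + (5 + n).choose (n + k)) :
    p ∣ 4785 ∨ p ∣ 2673 ∨ p ∣ 693 := by
  rcases Nat.lt_or_ge 5 k with hk5 | hk5
  · rw [Nat.choose_eq_zero_of_lt (show 5 + n < n + k by omega), add_zero] at h
    have := (hp.dvd_factorial).1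
      (h.trans (Dvd.intro _ ((mul_assoc _ _ _).symm.trans
        (Nat.choose_mul_factorial_mul_factorial (show k ≤ 5 + n by omega)))))
    omega
  have hN : (2 * n : ZMod p) = -1 := by
    rw [eq_neg_iff_add_eq_zero]
    exact_mod_cast (ZMod.natCast_eq_zero_iff _ _).2 (dvd_of_eq hpn)
  have hsymm : (5 + n).choose (n + k) = (5 + n).choose (5 - k) :=
    Nat.choose_symm_of_eq_add (by omega)
  have hdesc : ∀ j, ((5 + n).descFactorial j : ZMod p) = (j.factorial : ZMod p) *
      ((5 + n).choose j : ZMod p) := fun j => by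
    rw [Nat.descFactorial_eq_factorial_mul_choose, Nat.cast_mul]
  have h2 := hdesc 2
  have h3 := hdesc 3
  have h4 := hdesc 4
  have h5 := hdesc 5
  have e1 : 5 + n - 1 = n + 4 := by omega
  have e2 : 5 + n - 2 = n + 3 := by omega
  have e3 : 5 + n - 3 = n + 2 := by omega
  have e4 : 5 + n - 4 = n + 1 := by omega
  simp only [Nat.descFactorial_succ, Nat.descFactorial_zero, e1, e2, e3, e4, Nat.sub_zero,
    Nat.factorial] at h2 h3 h4 h5
  push_cast at h2 h3 h4 h5
  rw [hsymm, ← ZMod.natCast_eq_zero_iff] at h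
  have h05 : (1 + (5 + n).choose 5 : ZMod p) = 0 → p ∣ 4785 := fun h => by
    rw [← ZMod.natCast_eq_zero_iff]
    push_cast
    linear_combination 3840 * h + 32 * h5 -
      (16 * n ^ 4 + 232 * n ^ 3 + 1244 * n ^ 2 + 2978 * n + 2895) * hN
  have h14 : ((5 + n) + (5 + n).choose 4 : ZMod p) = 0 → p ∣ 2673 := fun h => by
    rw [← ZMod.natCast_eq_zero_iff]
    push_cast
    linear_combination 384 * h + 16 * h4 - (8 * n ^ 3 + 108 * n ^ 2 + 514 * n + 1167) * hN
  have h23 : ((5 + n).choose 2 + (5 + n).choose 3 : ZMod p) = 0 → p ∣ 693 := fun h => by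
    rw [← ZMod.natCast_eq_zero_iff]
    push_cast
    linear_combination 48 * h + 24 * h2 + 8 * h3 - (4 * n ^ 2 + 58 * n + 267) * hN
  interval_cases k <;> norm_num at h
  · exact .inl (h05 h)
  · exact .inr (.inl (h14 h))
  · exact .inr (.inr (h23 h))
  · exact .inr (.inr (h23 (by rw [add_comm, h])))
  · exact .inr (.inl (h14 (by rw [add_comm, h])))
  · exact .inl (h05 (by rw [add_comm, h]))

/-- `E(5) = {29}`: the primes `p ≡ 1 (mod 4)` with `p ∣ D_p^(5)`
are exactly those in `{29}`. -/
theorem stmt7 : Eset 5 = ({29} : Set ℕ) := by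
  ext p
  simp only [Eset, Set.mem_ofPred_eq, Set.mem_singleton_iff]
  constructor
  · rintro ⟨hp, hp4, h⟩
    have hp2 := hp.two_le
    by_cases hp13 : p < 13
    · have hp5 : p = 5 := by
        interval_cases p <;> first | rfl | omega | (exfalso; revert hp; norm_num)
      subst hp5
      have hD : Dp 5 5 = 59049 := by
        rw [Dp, Matrix.det_fin_two]
        simp only [Dmat, Matrix.of_apply]
        norm_num
      rw [hD] at h
      norm_num at h
    · obtain ⟨k, hk, hdvd⟩ := (dvd_Dp_iff hp hp4 (by omega)).1 h
      have hprod : p ∣ 3 ^ 8 * 5 * 7 * 11 ^ 3 * 29 := by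
        rcases dvd_of_dvd_choose_add_choose hp (by omega) (by omega) hk hdvd with h | h | h <;>
          exact h.trans (by norm_num)
      have hcases : p = 3 ∨ p = 5 ∨ p = 7 ∨ p = 11 ∨ p = 29 := by
        simp only [hp.dvd_mul, Nat.prime_dvd_prime_iff_eq hp Nat.prime_five,
          Nat.prime_dvd_prime_iff_eq hp (show Nat.Prime 7 by norm_num),
          Nat.prime_dvd_prime_iff_eq hp (show Nat.Prime 29 by norm_num)] at hprod
        rcases hprod with (((h | h) | h) | h) | h
        · exact .inl ((Nat.prime_dvd_prime_iff_eq hp Nat.prime_three).1 (hp.dvd_of_dvd_pow h))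
        · simp [h]
        · simp [h]
        · have := (Nat.prime_dvd_prime_iff_eq hp Nat.prime_eleven).1 (hp.dvd_of_dvd_pow h)
          simp [this]
        · simp [h]
      omega
  · rintro rfl
    exact ⟨by norm_num, by norm_num, (dvd_Dp_iff (by norm_num) (by norm_num) (by norm_num)).2
      ⟨0, by norm_num, by norm_num [Nat.choose]⟩⟩
end

section
/- Let p be a prime with p ≡ 1 (mod 4), and let √D_p^(1) denote the nonnegative integer whose square is D_p^(1). Then the Legendre symbol (√D_p^(1)/p) equals (−1)^{N} · (p/3), where N = #{k : 0 < k < p/4 and (k/p) = −1} and (p/3) is the Legendre symbol of p modulo 3. -/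
open Finset
open scoped Nat

namespace Matrix

variable {α R : Type*} [Fintype α] [DecidableEq α] [CommRing R]

theorem det_fromBlocks_zero_one_neg_one_zero :
    (fromBlocks 0 1 (-1) 0 : Matrix (α ⊕ α) (α ⊕ α) R).det = 1 := by
  have h : (fromBlocks 0 1 (-1) 0 : Matrix (α ⊕ α) (α ⊕ α) R) =
      fromBlocks 1 1 0 1 * fromBlocks 1 0 (-1) 1 * fromBlocks 1 1 0 1 := by
    simp [fromBlocks_multiply]
  rw [h]
  simp only [det_mul, det_fromBlocks_zero₂₁, det_fromBlocks_zero₁₂, det_one, mul_one]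

theorem det_fromBlocks_zero_neg_zero (A : Matrix α α R) :
    (fromBlocks 0 A (-A) 0).det = A.det ^ 2 := by
  have h : fromBlocks 0 A (-A) 0 = fromBlocks A 0 0 A * fromBlocks 0 1 (-1) 0 := by
    simp [fromBlocks_multiply]
  rw [h, det_mul, det_fromBlocks_zero_one_neg_one_zero, det_fromBlocks_zero₂₁, mul_one, sq]

theorem det_fromBlocks_zero_self_zero (A : Matrix α α R) :
    (fromBlocks 0 A A 0).det = (-1) ^ Fintype.card α * A.det ^ 2 := by
  have h : fromBlocks 0 A A 0 = fromBlocks 0 A (-A) 0 * fromBlocks (-1) 0 0 1 := by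
    simp [fromBlocks_multiply]
  rw [h, det_mul, det_fromBlocks_zero_neg_zero, det_fromBlocks_zero₂₁, det_neg, det_one,
    mul_one, mul_one, mul_comm]

end Matrix

theorem sub_pow_two_mul_add_one {R : Type*} [CommRing R] (x y : R) (m : ℕ) :
    (x - y) ^ (2 * m + 1) = ∑ k ∈ range (m + 1), (-1) ^ k * ((2 * m + 1).choose k : R) *
      (x ^ (2 * m + 1 - k) * y ^ k - x ^ k * y ^ (2 * m + 1 - k)) := by
  rw [sub_eq_add_neg, add_pow, show 2 * m + 1 + 1 = (m + 1) + (m + 1) by ring, sum_range_add,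
    ← sum_range_reflect (fun k => x ^ (m + 1 + k) * _ * _), ← sum_add_distrib]
  refine sum_congr rfl fun k hk => ?_
  have hk' : k ≤ m := by simpa [Nat.lt_succ_iff] using hk
  obtain ⟨c, rfl⟩ := Nat.exists_eq_add_of_le hk'
  have h1 : k + c + 1 + (k + c + 1 - 1 - k) = 2 * (k + c) + 1 - k := by omega
  have h2 : 2 * (k + c) + 1 - (2 * (k + c) + 1 - k) = k := by omega
  rw [h1, h2, Nat.choose_symm (by omega), show 2 * (k + c) + 1 - k = k + 2 * c + 1 by omega,
    neg_pow y, neg_pow y]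
  have h3 : (-1 : R) ^ (k + 2 * c + 1) = - (-1) ^ k := by
    rw [pow_succ, pow_add, pow_mul]; simp
  rw [h3]; ring

theorem prod_range_factorial_mul_factorial (m : ℕ) :
    ∏ k ∈ range (m + 1), k ! * (2 * m + 1 - k)! =
      ∏ j ∈ range (m + 1), (2 * j)! * (2 * j + 1)! := by
  have h (n : ℕ) : ∏ j ∈ range n, (2 * j)! * (2 * j + 1)! = ∏ k ∈ range (2 * n), k ! := by
    induction n with
    | zero => simp
    | succ n ih =>
      rw [prod_range_succ, ih, Nat.mul_succ, prod_range_succ, prod_range_succ, mul_assoc]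
  rw [h, two_mul (m + 1), prod_range_add _ (m + 1) (m + 1), prod_mul_distrib,
    ← prod_range_reflect (fun k => (m + 1 + k)!)]
  congr 1
  refine prod_congr rfl fun k hk => ?_
  have := mem_range.1 hk
  congr 1
  omega

theorem prod_choose_mul_prod_factorial (m : ℕ) :
    (∏ k ∈ range (m + 1), (2 * m + 1).choose k) * ∏ j ∈ range (m + 1), (2 * j)! * (2 * j + 1)! =
      (2 * m + 1)! ^ (m + 1) := by
  rw [← prod_range_factorial_mul_factorial, ← prod_mul_distrib,
    prod_congr rfl (g := fun _ => (2 * m + 1)!), prod_const, card_range]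
  intro k hk
  have := mem_range.1 hk
  rw [← mul_assoc, Nat.choose_mul_factorial_mul_factorial (by omega)]

theorem prod_odd_mul_two_pow_mul_factorial (m : ℕ) :
    (∏ j ∈ range (m + 1), (2 * j + 1)) * (2 ^ m * m !) = (2 * m + 1)! := by
  rw [Nat.factorial_eq_mul_doubleFactorial, Nat.doubleFactorial_two_mul,
    Nat.doubleFactorial_eq_prod_odd, prod_range_succ']
  simp

section
variable {p : ℕ} [Fact p.Prime] {m : ℕ}

theorem ZMod.sum_univ_eq_sum_range {M : Type*} [AddCommMonoid M] (n : ℕ) [NeZero n]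
    (f : ZMod n → M) : ∑ x, f x = ∑ a ∈ range n, f a := by
  obtain ⟨k, rfl⟩ := Nat.exists_eq_succ_of_ne_zero (NeZero.ne n)
  rw [← Fin.sum_univ_eq_sum_range (fun a => f a)]
  refine sum_congr rfl fun x _ => ?_
  congr 1
  exact (ZMod.natCast_zmod_val (n := k + 1) x).symm

theorem natCast_add_one_eq_neg_reflect {n : ℕ} (h : p = 2 * n + 1) (i : ℕ) (hi : i < n) :
    ((n + i : ℕ) : ZMod p) + 1 = - (((n - 1 - i : ℕ) : ZMod p) + 1) := by
  have : (((n + i) + 1 + ((n - 1 - i) + 1) : ℕ) : ZMod p) = 0 := by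
    rw [show (n + i) + 1 + ((n - 1 - i) + 1) = p by omega, ZMod.natCast_self]
  push_cast at this ⊢
  linear_combination this

theorem ZMod.sum_sq_pow {n : ℕ} (h : p = 2 * n + 1) (j : ℕ) (hj : j ≠ 0) :
    ∑ i : Fin n, ((((i : ℕ) : ZMod p) + 1) ^ 2) ^ j = if n ∣ j then (n : ZMod p) else 0 := by
  have hp0 : ((2 * n + 1 : ℕ) : ZMod p) = 0 := by rw [← h]; exact ZMod.natCast_self p
  have h2 : (2 : ZMod p) ≠ 0 := by
    intro h2
    push_cast at hp0
    rw [h2] at hp0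
    simp at hp0
  have key : ∑ x : ZMod p, x ^ (2 * j) = if n ∣ j then -1 else 0 := by
    have := FiniteField.sum_pow_units (ZMod p) (2 * j)
    rw [ZMod.card, show p - 1 = 2 * n by omega] at this
    simp only [Nat.mul_dvd_mul_iff_left two_pos] at this
    rw [← this, ← Finset.sum_erase _ (a := (0 : ZMod p)) (by simp [hj])]
    symm
    refine Finset.sum_bij (fun u _ => (u : ZMod p)) (by simp) (by simp [Units.ext_iff]) ?_ (by simp)
    intro b hb
    exact ⟨Units.mk0 b (by simpa using hb), by simp, by simp⟩
  rw [Fin.sum_univ_eq_sum_range (fun i => ((((i : ℕ) : ZMod p) + 1) ^ 2) ^ j)]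
  rw [ZMod.sum_univ_eq_sum_range] at key
  rw [show range p = range (2 * n + 1) by rw [h], sum_range_succ'] at key
  simp only [Nat.cast_zero, Nat.cast_add_one] at key
  rw [zero_pow (by omega), add_zero, two_mul n, sum_range_add,
    ← sum_range_reflect (fun k => (((n + k : ℕ) : ZMod p) + 1) ^ _)] at key
  have e : ∑ k ∈ range n, (((n + (n - 1 - k) : ℕ) : ZMod p) + 1) ^ (2 * j) =
      ∑ k ∈ range n, ((k : ZMod p) + 1) ^ (2 * j) := by
    refine sum_congr rfl fun k hk => ?_
    have := mem_range.1 hk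
    rw [natCast_add_one_eq_neg_reflect h _ (by omega), show n - 1 - (n - 1 - k) = k by omega, pow_mul, pow_mul,
      neg_sq]
  rw [e] at key
  simp only [← pow_mul]
  apply mul_left_cancel₀ h2
  rw [two_mul, key]
  push_cast at hp0
  split_ifs
  · linear_combination -hp0
  · simp

theorem factorial_sq_eq_neg_one (h : p = 4 * m + 1) : ((2 * m)! : ZMod p) ^ 2 = -1 := by
  have w := ZMod.wilsons_lemma p
  rw [show p - 1 = 2 * m + 2 * m by omega, ← prod_range_add_one_eq_factorial, prod_range_add,
    ← prod_range_reflect (fun k => 2 * m + k + 1)] at w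
  have e : ∏ k ∈ range (2 * m), (((2 * m + (2 * m - 1 - k) : ℕ) : ZMod p) + 1) =
      ∏ k ∈ range (2 * m), ((k : ZMod p) + 1) := by
    have : ∏ k ∈ range (2 * m), (((2 * m + (2 * m - 1 - k) : ℕ) : ZMod p) + 1) =
      ∏ k ∈ range (2 * m), -((k : ZMod p) + 1) := by
      refine prod_congr rfl fun k hk => ?_
      have := mem_range.1 hk
      rw [natCast_add_one_eq_neg_reflect (by omega) _ (by omega),
        show 2 * m - 1 - (2 * m - 1 - k) = k by omega]
    rw [this, prod_neg]
    simp
  rw [← w, ← prod_range_add_one_eq_factorial]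
  push_cast at e ⊢
  rw [e, sq]
end

section
open Matrix

/-- Lists the exponents `1, …, 2 * m` in pairs `(k, 2 * m + 1 - k)`. -/
def pairedExponent (m : ℕ) : Fin m ⊕ Fin m → ℕ :=
  Sum.elim (fun a => a + 1) (fun a => 2 * m - a)

/-- The Vandermonde-type matrix of the powers `y i ^ k`, with the exponents `1 ≤ k ≤ 2 * m`
listed by `pairedExponent`. -/
def pairedVandermonde {R : Type*} [CommRing R] {m : ℕ} (y : Fin m ⊕ Fin m → R) :
    Matrix (Fin m ⊕ Fin m) (Fin m ⊕ Fin m) R :=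
  of fun i k => y i ^ pairedExponent m k

/-- The coefficient of `x ^ (a + 1) * y ^ (2 * m - a)` in `(x - y) ^ (2 * m + 1)`, reduced using
`x ^ (2 * m) = y ^ (2 * m) = 1`. -/
def pairedCoeff (R : Type*) [CommRing R] (m a : ℕ) : R :=
  (-1) ^ a * ((2 * m + 1).choose (a + 1) : R) + if a = 0 then 1 else 0

theorem sub_pow_eq_sum_pairedCoeff {R : Type*} [CommRing R] {m : ℕ} (hm : m ≠ 0) {x y : R}
    (hx : x ^ (2 * m) = 1) (hy : y ^ (2 * m) = 1) :
    (x - y) ^ (2 * m + 1) = ∑ a : Fin m, pairedCoeff R m a *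
      (x ^ ((a : ℕ) + 1) * y ^ (2 * m - a) - x ^ (2 * m - a) * y ^ ((a : ℕ) + 1)) := by
  rw [Fin.sum_univ_eq_sum_range (fun a => pairedCoeff R m a *
    (x ^ (a + 1) * y ^ (2 * m - a) - x ^ (2 * m - a) * y ^ (a + 1))), sub_pow_two_mul_add_one,
    sum_range_succ']
  simp only [pairedCoeff, add_mul, sum_add_distrib, ite_mul, one_mul, zero_mul]
  congr 1
  · refine sum_congr rfl fun a ha => ?_
    rw [show 2 * m + 1 - (a + 1) = 2 * m - a by omega, pow_succ (-1 : R)]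
    ring
  · rw [sum_ite_eq' (range m) 0, if_pos (by simpa using Nat.pos_of_ne_zero hm)]
    simp only [Nat.sub_zero, pow_succ, hx, hy, Nat.choose_zero_right]
    simp

theorem det_sub_pow_eq_sq {R : Type*} [CommRing R] {m : ℕ} (hm : m ≠ 0) {y : Fin m ⊕ Fin m → R}
    (hy : ∀ i, y i ^ (2 * m) = 1) :
    (of fun i j => (y i - y j) ^ (2 * m + 1)).det =
      ((pairedVandermonde y).det * ∏ a ∈ range m, pairedCoeff R m a) ^ 2 := by
  have h : (of fun i j => (y i - y j) ^ (2 * m + 1)) = pairedVandermonde y *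
      (fromBlocks 0 (diagonal fun a : Fin m => pairedCoeff R m a)
        (-diagonal fun a : Fin m => pairedCoeff R m a) 0) * (pairedVandermonde y)ᵀ := by
    rw [diagonal_neg]
    ext i j
    rw [of_apply, sub_pow_eq_sum_pairedCoeff hm (hy i) (hy j)]
    simp only [mul_apply, Fintype.sum_sum_type, fromBlocks_apply₁₁, fromBlocks_apply₁₂,
      fromBlocks_apply₂₁, fromBlocks_apply₂₂, diagonal_apply, Matrix.zero_apply, mul_zero,
      transpose_apply, zero_add, add_zero, mul_ite, sum_ite_eq', mem_univ, if_true, ← sum_add_distrib]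
    refine sum_congr rfl fun a _ => ?_
    simp only [pairedVandermonde, of_apply, pairedExponent, Sum.elim_inl, Sum.elim_inr]
    ring
  rw [h, det_mul, det_mul, det_transpose, det_fromBlocks_zero_neg_zero, det_diagonal,
    Fin.prod_univ_eq_prod_range (pairedCoeff R m)]
  ring

theorem det_pairedVandermonde_sq {p m : ℕ} [Fact p.Prime] (h : p = 4 * m + 1)
    (e : Fin m ⊕ Fin m ≃ Fin (2 * m)) :
    (pairedVandermonde fun i => (((e i : ℕ) : ZMod p) + 1) ^ 2).det ^ 2 =
      (-1) ^ (m + 1) * (2 * m : ZMod p) ^ (2 * m) := by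
  set y : Fin m ⊕ Fin m → ZMod p := fun i => (((e i : ℕ) : ZMod p) + 1) ^ 2 with hy
  let W : Matrix (Fin m ⊕ Fin m) (Fin m ⊕ Fin m) (ZMod p) :=
    of fun i k => y i ^ (pairedExponent m k - 1)
  have hexp (k : Fin m ⊕ Fin m) : pairedExponent m k ≠ 0 := by
    rcases k with a | a <;> have := a.2 <;>
      simp only [pairedExponent, Sum.elim_inl, Sum.elim_inr] <;> omega
  have hprod : ∏ i, y i = -1 := by
    rw [← factorial_sq_eq_neg_one h, hy, prod_pow, e.prod_comp (fun i => ((i : ℕ) : ZMod p) + 1),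
      Fin.prod_univ_eq_prod_range (fun i => (i : ZMod p) + 1), ← prod_range_add_one_eq_factorial]
    push_cast
    rfl
  have h1 : (pairedVandermonde y).det = - W.det := by
    have : pairedVandermonde y = of fun i k => y i * W i k := by
      ext i k
      simp only [pairedVandermonde, W, of_apply]
      rw [← pow_succ', Nat.sub_add_cancel (Nat.pos_of_ne_zero (hexp k))]
    rw [this, det_mul_column, hprod, neg_one_mul]
  have h2 : (pairedVandermonde y)ᵀ * W =
      fromBlocks 0 (diagonal fun _ => (2 * m : ZMod p)) (diagonal fun _ => (2 * m : ZMod p)) 0 := by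
    have hle (k : Fin m ⊕ Fin m) : pairedExponent m k ≤ 2 * m := by
      rcases k with a | a <;> have := a.2 <;>
        simp only [pairedExponent, Sum.elim_inl, Sum.elim_inr] <;> omega
    have hs (k l : Fin m ⊕ Fin m) : ((pairedVandermonde y)ᵀ * W) k l =
        if pairedExponent m k + pairedExponent m l = 2 * m + 1 then (2 * m : ZMod p) else 0 := by
      simp only [mul_apply, transpose_apply, pairedVandermonde, W, of_apply, ← pow_add]
      have := hexp k
      have := hexp l
      have := hle k
      have := hle l
      rw [hy, e.sum_comp (fun i => ((((i : ℕ) : ZMod p) + 1) ^ 2) ^ _),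
        ZMod.sum_sq_pow (by omega) _ (by omega)]
      push_cast
      refine if_congr ⟨fun ⟨c, hc⟩ => ?_, fun h => ⟨1, by omega⟩⟩ rfl rfl
      have : c < 2 := by
        by_contra! hc2
        have := Nat.mul_le_mul_left (2 * m) hc2
        omega
      interval_cases c <;> omega
    ext (a | a) (b | b) <;> have ha := a.2 <;> have hb := b.2 <;>
      rw [hs] <;>
      simp only [fromBlocks_apply₁₁, fromBlocks_apply₁₂, fromBlocks_apply₂₁,
        fromBlocks_apply₂₂, diagonal_apply, pairedExponent, Sum.elim_inl, Sum.elim_inr,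
        Matrix.zero_apply, Fin.ext_iff]
    · exact if_neg (by omega)
    · exact if_congr (by omega) rfl rfl
    · exact if_congr (by omega) rfl rfl
    · exact if_neg (by omega)
  have h3 := congrArg det h2
  rw [det_mul, det_transpose, det_fromBlocks_zero_self_zero, det_diagonal, prod_const, card_univ,
    Fintype.card_fin, ← pow_mul, mul_comm m 2] at h3
  rw [sq, pow_succ]
  nth_rewrite 2 [h1]
  linear_combination -h3
end

section
variable {p : ℕ} [Fact p.Prime] {m : ℕ}

theorem quadraticChar_two_of_eq (h : p = 4 * m + 1) : quadraticChar (ZMod p) 2 = (-1) ^ m := by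
  have hp2 : p ≠ 2 := by omega
  have := legendreSym.at_two hp2
  rw [legendreSym] at this
  push_cast at this
  rw [this, ZMod.χ₈_nat_eq_if_mod_eight]
  rcases Nat.even_or_odd m with hm | hm
  · rw [hm.neg_one_pow]
    obtain ⟨c, rfl⟩ := hm
    rw [if_neg (by omega), if_pos (by omega)]
  · rw [hm.neg_one_pow]
    obtain ⟨c, rfl⟩ := hm
    rw [if_neg (by omega), if_neg (by omega)]

theorem cast_quadraticChar_eq_pow (h : p = 4 * m + 1) (a : ZMod p) :
    (quadraticChar (ZMod p) a : ZMod p) = a ^ (2 * m) := by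
  rw [quadraticChar_eq_pow_of_char_ne_two' (by rw [ZMod.ringChar_zmod_n]; omega), ZMod.card]
  congr 1
  omega

theorem quadraticChar_neg_one_of_eq (h : p = 4 * m + 1) : quadraticChar (ZMod p) (-1) = 1 := by
  rw [quadraticChar_neg_one (by rw [ZMod.ringChar_zmod_n]; omega), ZMod.card,
    ZMod.χ₄_nat_one_mod_four (by omega)]

theorem quadraticChar_eq_of_pow_eq (h : p = 4 * m + 1) {a : ZMod p} {k : ℕ}
    (ha : a ^ (2 * m) = (-1) ^ k) : quadraticChar (ZMod p) a = (-1) ^ k := by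
  have hc : ringChar (ZMod p) ≠ 2 := by rw [ZMod.ringChar_zmod_n]; omega
  refine Int.cast_injOn_of_ringChar_ne_two hc (quadraticChar_isQuadratic (ZMod p) a) ?_ ?_
  · rcases neg_one_pow_eq_or ℤ k with h | h <;> simp [h]
  · rw [cast_quadraticChar_eq_pow h, ha]
    simp

theorem quadraticChar_of_sq_eq_neg_one (h : p = 4 * m + 1) {a : ZMod p} (ha : a ^ 2 = -1) :
    quadraticChar (ZMod p) a = (-1) ^ m :=
  quadraticChar_eq_of_pow_eq h (by rw [pow_mul, ha])

theorem quadraticChar_det_pairedVandermonde (h : p = 4 * m + 1)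
    (e : Fin m ⊕ Fin m ≃ Fin (2 * m)) :
    quadraticChar (ZMod p) (pairedVandermonde fun i => (((e i : ℕ) : ZMod p) + 1) ^ 2).det =
      (-1) ^ m := by
  refine quadraticChar_of_sq_eq_neg_one h ?_
  have h2 : (2 : ZMod p) ^ (2 * m) = (-1) ^ m := by
    rw [← cast_quadraticChar_eq_pow h, quadraticChar_two_of_eq h]
    simp
  have h4 : (2 : ZMod p) * (2 * m) = -1 := by
    have : ((4 * m + 1 : ℕ) : ZMod p) = 0 := by rw [← h, ZMod.natCast_self]
    push_cast at this
    linear_combination this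
  have h5 : (-1) ^ m * (2 * m : ZMod p) ^ (2 * m) = 1 := by
    rw [← h2, ← mul_pow, h4, (even_two_mul m).neg_one_pow]
  rw [det_pairedVandermonde_sq h, pow_succ]
  linear_combination -h5

theorem prod_pairedCoeff_mul (h : p = 4 * m + 1) :
    (∏ a ∈ range m, pairedCoeff (ZMod p) m a) * (2 * m + 1) =
      (2 * m + 2) * ((-1) ^ (∑ a ∈ range m, a) *
        ∏ k ∈ range (m + 1), ((2 * m + 1).choose k : ZMod p)) := by
  have hm : m ≠ 0 := by rintro rfl; exact (Fact.out : p.Prime).ne_one h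
  obtain ⟨c, rfl⟩ := Nat.exists_eq_succ_of_ne_zero hm
  rw [prod_range_succ' _ (c + 1), ← prod_pow_eq_pow_sum, Nat.choose_zero_right, Nat.cast_one, mul_one,
    ← prod_mul_distrib, prod_range_succ', prod_range_succ' _ c]
  simp [pairedCoeff]
  ring

theorem natCast_ne_zero_of_lt {a : ℕ} (h0 : a ≠ 0) (h : a < p) : (a : ZMod p) ≠ 0 := by
  rw [Ne, ZMod.natCast_eq_zero_iff]
  exact Nat.not_dvd_of_pos_of_lt (Nat.pos_of_ne_zero h0) h

theorem natCast_factorial_ne_zero {a : ℕ} (h : a < p) : (a ! : ZMod p) ≠ 0 := by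
  rw [Ne, ZMod.natCast_eq_zero_iff, (Fact.out : p.Prime).dvd_factorial]
  omega

theorem jacobiSym_eq_quadraticChar (a : ℤ) : jacobiSym a p = quadraticChar (ZMod p) a := by
  rw [← jacobiSym.legendreSym.to_jacobiSym, legendreSym]

theorem quadraticChar_factorial {k : ℕ} (hk : k < p) :
    quadraticChar (ZMod p) (k ! : ZMod p) =
      (-1) ^ ((Finset.Ioc 0 k).filter (fun k : ℕ => jacobiSym k p = -1)).card := by
  have hI : Ioc 0 k = Ico 1 (k + 1) := by
    ext
    simp only [mem_Ioc, mem_Ico]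
    omega
  rw [← prod_Ico_id_eq_factorial, hI, Nat.cast_prod, map_prod, ← prod_const,
    ← prod_filter_mul_prod_filter_not (Ico 1 (k + 1)) (fun k : ℕ => jacobiSym k p = -1)]
  have h (a : ℕ) : jacobiSym a p = quadraticChar (ZMod p) a := by
    rw [jacobiSym_eq_quadraticChar, Int.cast_natCast]
  simp only [h]
  rw [prod_congr rfl (fun a ha => (mem_filter.1 ha).2)]
  refine (congrArg _ (prod_eq_one fun a ha => ?_)).trans (mul_one _)
  rw [mem_filter, mem_Ico] at ha
  exact (quadraticChar_dichotomy (natCast_ne_zero_of_lt (by omega) (by omega))).resolve_right ha.2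

theorem quadraticChar_two_mul_add_one (h : p = 4 * m + 1) :
    quadraticChar (ZMod p) (2 * m + 1) = (-1) ^ m := by
  have h0 : ((4 * m + 1 : ℕ) : ZMod p) = 0 := by rw [← h, ZMod.natCast_self]
  have h1 : (2 * m + 1 : ZMod p) * 2 = 1 := by
    push_cast at h0
    linear_combination h0
  have h2 := congrArg (quadraticChar (ZMod p)) h1
  rw [map_mul, map_one, quadraticChar_two_of_eq h] at h2
  rcases neg_one_pow_eq_or ℤ m with h3 | h3 <;> rw [h3] at h2 ⊢ <;> linarith

theorem quadraticChar_two_mul_add_two (h : p = 4 * m + 1) :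
    quadraticChar (ZMod p) (2 * m + 2) = (-1) ^ m * quadraticChar (ZMod p) 3 := by
  have h0 : ((4 * m + 1 : ℕ) : ZMod p) = 0 := by rw [← h, ZMod.natCast_self]
  have h1 : (2 * m + 2 : ZMod p) * 2 = 3 := by
    push_cast at h0
    linear_combination h0
  rw [← h1, map_mul, quadraticChar_two_of_eq h]
  rcases neg_one_pow_eq_or ℤ m with h3 | h3 <;> rw [h3] <;> ring

theorem quadraticChar_factorial_two_mul_add_one (h : p = 4 * m + 1) :
    quadraticChar (ZMod p) ((2 * m + 1)! : ℕ) = 1 := by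
  rw [Nat.factorial_succ, Nat.cast_mul, map_mul,
    quadraticChar_of_sq_eq_neg_one h (factorial_sq_eq_neg_one h)]
  push_cast
  rw [quadraticChar_two_mul_add_one h, ← mul_pow]
  simp

theorem quadraticChar_prod_choose (h : p = 4 * m + 1) :
    quadraticChar (ZMod p) (∏ k ∈ range (m + 1), ((2 * m + 1).choose k : ZMod p)) =
      (-1) ^ m * quadraticChar (ZMod p) (m ! : ZMod p) := by
  have h1 := congrArg (fun a : ℕ => quadraticChar (ZMod p) a) (prod_choose_mul_prod_factorial m)
  have h2 := congrArg (fun a : ℕ => quadraticChar (ZMod p) a)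
    (prod_odd_mul_two_pow_mul_factorial m)
  have h3 : quadraticChar (ZMod p) ((∏ j ∈ range (m + 1), (2 * j)! * (2 * j + 1)! : ℕ) : ZMod p) =
      quadraticChar (ZMod p) ((∏ j ∈ range (m + 1), (2 * j + 1) : ℕ) : ZMod p) := by
    rw [Nat.cast_prod, Nat.cast_prod, map_prod, map_prod]
    refine prod_congr rfl fun j hj => ?_
    have := mem_range.1 hj
    rw [Nat.factorial_succ, mul_left_comm, ← sq, Nat.cast_mul, map_mul, Nat.cast_pow,
      quadraticChar_sq_one' (natCast_factorial_ne_zero (by omega)), mul_one]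
  simp only [Nat.cast_mul, Nat.cast_pow, map_mul, map_pow, h3,
    quadraticChar_factorial_two_mul_add_one h, one_pow] at h1 h2
  rw [Nat.cast_ofNat, quadraticChar_two_of_eq h] at h2
  have h4 : (((-1) ^ m) ^ m : ℤ) = (-1) ^ m := by
    rcases Nat.even_or_odd m with hm | hm <;> simp [hm.neg_one_pow]
  rw [h4] at h2
  rw [← Nat.cast_prod]
  linear_combination ((-1) ^ m * quadraticChar (ZMod p) (m ! : ZMod p)) * h1 -
    quadraticChar (ZMod p) ((∏ k ∈ range (m + 1), (2 * m + 1).choose k : ℕ) : ZMod p) * h2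

theorem quadraticChar_prod_pairedCoeff (h : p = 4 * m + 1) :
    quadraticChar (ZMod p) (∏ a ∈ range m, pairedCoeff (ZMod p) m a) =
      (-1) ^ m * quadraticChar (ZMod p) 3 * quadraticChar (ZMod p) (m ! : ZMod p) := by
  have h1 := congrArg (quadraticChar (ZMod p)) (prod_pairedCoeff_mul h)
  rw [map_mul, map_mul, map_mul, map_pow, quadraticChar_neg_one_of_eq h, one_pow, one_mul,
    quadraticChar_two_mul_add_one h, quadraticChar_two_mul_add_two h,
    quadraticChar_prod_choose h] at h1
  rcases neg_one_pow_eq_or ℤ m with h3 | h3 <;> rw [h3] at h1 ⊢ <;> linarith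

theorem cast_Dp_one (h : p = 4 * m + 1) (e : Fin m ⊕ Fin m ≃ Fin (2 * m)) :
    (Dp p 1 : ZMod p) =
      ((pairedVandermonde fun i => (((e i : ℕ) : ZMod p) + 1) ^ 2).det *
        ∏ a ∈ range m, pairedCoeff (ZMod p) m a) ^ 2 := by
  have hm : m ≠ 0 := by rintro rfl; exact (Fact.out : p.Prime).ne_one h
  rw [← det_sub_pow_eq_sq hm, Dp, Int.cast_det,
    ← Matrix.det_submatrix_equiv_self (e.trans (finCongr (by omega : 2 * m = (p - 1) / 2)))]
  · congr 1
    ext i j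
    simp only [Matrix.submatrix_apply, Matrix.map_apply, Dmat, Matrix.of_apply, Equiv.trans_apply,
      finCongr_apply, Fin.val_cast, pow_one, Int.cast_mul, jacobiSym_eq_quadraticChar,
      cast_quadraticChar_eq_pow h]
    push_cast
    ring
  · intro i
    have := (e i).2
    rw [← pow_mul, show 2 * (2 * m) = p - 1 by omega]
    refine ZMod.pow_card_sub_one_eq_one ?_
    exact_mod_cast natCast_ne_zero_of_lt (a := (e i : ℕ) + 1) (by omega) (by omega)

end

/-- For a prime `p ≡ 1 (mod 4)`, letting `t = √D_p^(1)` be the nonnegative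
integer with `t² = D_p^(1)`, the Legendre symbol `(t/p)` equals `(−1)^N · (p/3)`, where
`N = #{k : 0 < k < p/4, (k/p) = −1}`. (Note `k < p/4` over the reals is `k ≤ p/4` with
natural division since `4 ∤ p`; Legendre symbols are expressed via Jacobi symbols.) -/
theorem stmt14 (p : ℕ) (hp : p.Prime) (h4 : p % 4 = 1)
    (t : ℤ) (ht : 0 ≤ t) (htsq : t ^ 2 = Dp p 1) :
    jacobiSym t p =
      (-1) ^ ((Finset.Ioc 0 (p / 4)).filter (fun k : ℕ => jacobiSym k p = -1)).card *
        jacobiSym p 3 := by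
  have := Fact.mk hp
  obtain ⟨m, h⟩ : ∃ m, p = 4 * m + 1 := ⟨p / 4, by omega⟩
  let e : Fin m ⊕ Fin m ≃ Fin (2 * m) := finSumFinEquiv.trans (finCongr (by omega))
  have h1 := congrArg (Int.cast : ℤ → ZMod p) htsq
  rw [Int.cast_pow, cast_Dp_one h e, sq_eq_sq_iff_eq_or_eq_neg] at h1
  have h3 : jacobiSym p 3 = quadraticChar (ZMod p) 3 := by
    have := jacobiSym.quadratic_reciprocity_one_mod_four h4 (b := 3) (by decide)
    rw [Nat.cast_ofNat] at this
    rw [this, jacobiSym_eq_quadraticChar, Int.cast_ofNat]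
  have h2 : quadraticChar (ZMod p) (t : ZMod p) =
      quadraticChar (ZMod p) ((pairedVandermonde fun i => (((e i : ℕ) : ZMod p) + 1) ^ 2).det *
        ∏ a ∈ range m, pairedCoeff (ZMod p) m a) := by
    rcases h1 with h1 | h1 <;> rw [h1]
    rw [neg_eq_neg_one_mul, map_mul, quadraticChar_neg_one_of_eq h, one_mul]
  rw [jacobiSym_eq_quadraticChar, h2, map_mul, quadraticChar_det_pairedVandermonde h,
    quadraticChar_prod_pairedCoeff h, h3, show p / 4 = m by omega,
    ← quadraticChar_factorial (by omega)]
  rcases neg_one_pow_eq_or ℤ m with h5 | h5 <;> rw [h5] <;> ring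
end

section
/- Let p be a prime with p ≡ 1 (mod 4), and let √D_p^(3) denote the nonnegative integer whose square is D_p^(3). Then the Legendre symbol (√D_p^(3)/p) equals (−1)^{N} · (p/(4 + (−1)^{(p−1)/4})), where N = #{k : 0 < k < p/4 and (k/p) = −1}; here 4 + (−1)^{(p−1)/4} equals 5 if (p−1)/4 is even and 3 if (p−1)/4 is odd, and (p/5), (p/3) are Legendre symbols. -/
theorem det_mul_sum_div_pow {F : Type*} [Field F] {n : ℕ} (x w : Fin n → F)
    (hinj : Function.Injective x) (hx0 : ∀ i, x i ≠ 0) (hx : ∀ i, x i ^ n = 1) (c : ℕ → F) :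
    (Matrix.of fun i j => w j * ∑ k ∈ Finset.range n, c k * (x i / x j) ^ k).det =
      (n : F) ^ n * (∏ j, w j) * ∏ k ∈ Finset.range n, c k := by
  have horth : Matrix.vandermonde x * (Matrix.vandermonde fun j => (x j)⁻¹).transpose =
      Matrix.diagonal fun _ => (n : F) := by
    ext i j
    rw [Matrix.mul_apply]
    simp only [Matrix.vandermonde_apply, Matrix.transpose_apply, ← mul_pow]
    rw [Fin.sum_univ_eq_sum_range (fun k => (x i * (x j)⁻¹) ^ k) n]
    by_cases hij : i = j
    · subst hij
      simp [hx0 i]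
    · rw [Matrix.diagonal_apply_ne _ hij]
      have h1 : x i * (x j)⁻¹ - 1 ≠ 0 := by
        intro h
        apply hij
        apply hinj
        have := hx0 j
        field_simp at h
        simpa [sub_eq_zero] using h
      have h2 := mul_geom_sum (x i * (x j)⁻¹) n
      rw [mul_pow, inv_pow, hx, hx] at h2
      simpa [h1] using h2
  have hfac : (Matrix.of fun i j => w j * ∑ k ∈ Finset.range n, c k * (x i / x j) ^ k) =
      Matrix.vandermonde x * Matrix.diagonal (fun k : Fin n => c k) *
        (Matrix.vandermonde fun j => (x j)⁻¹).transpose * Matrix.diagonal w := by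
    ext i j
    rw [Matrix.mul_diagonal, Matrix.mul_apply]
    simp only [Matrix.mul_diagonal, Matrix.vandermonde_apply, Matrix.transpose_apply,
      Matrix.of_apply]
    rw [Fin.sum_univ_eq_sum_range (fun k => x i ^ k * c k * (x j)⁻¹ ^ k) n, mul_comm]
    congr 1
    refine Finset.sum_congr rfl fun k _ => ?_
    rw [div_eq_mul_inv, mul_pow]
    ring
  have hdet := congrArg Matrix.det horth
  rw [Matrix.det_mul, Matrix.det_diagonal, Finset.prod_const, Finset.card_univ,
    Fintype.card_fin] at hdet
  rw [hfac, Matrix.det_mul, Matrix.det_mul, Matrix.det_mul, Matrix.det_diagonal,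
    Matrix.det_diagonal, ← hdet, Fin.prod_univ_eq_prod_range c n]
  ring

theorem sub_one_pow_of_pow_eq_one {R : Type*} [CommRing R] {n : ℕ} (hn : Even n) (h4 : 4 ≤ n)
    {z : R} (hz : z ^ n = 1) :
    (z - 1) ^ (n + 3) = ∑ k ∈ Finset.range n,
      ((-1) ^ (k + 1) * ((n + 3).choose k + (n + 3).choose (n + k) : ℕ)) * z ^ k := by
  have h1 : (z - 1) ^ (n + 3) =
      ∑ k ∈ Finset.range (n + 4), (-1) ^ (k + 1) * ((n + 3).choose k : R) * z ^ k := by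
    rw [sub_eq_add_neg, add_pow]
    refine Finset.sum_congr rfl fun k hk => ?_
    have hk' : k ≤ n + 3 := by simpa [Nat.lt_succ_iff] using hk
    have : (-1 : R) ^ (n + 3 - k) = (-1) ^ (k + 1) := by
      apply neg_one_pow_congr
      rw [Nat.even_sub hk']
      simp only [Nat.even_add, hn]
      grind
    rw [this]
    ring
  have h2 : ∑ k ∈ Finset.range (n + 4), (-1) ^ (k + 1) * ((n + 3).choose k : R) * z ^ k =
      ∑ k ∈ Finset.range (n + n), (-1) ^ (k + 1) * ((n + 3).choose k : R) * z ^ k := by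
    refine Finset.sum_subset (Finset.range_subset_range.2 (by omega)) fun k _ hk => ?_
    have hk' : n + 4 ≤ k := by simpa using hk
    rw [Nat.choose_eq_zero_of_lt (by omega)]
    simp
  rw [h1, h2, Finset.sum_range_add, ← Finset.sum_add_distrib]
  refine Finset.sum_congr rfl fun k _ => ?_
  rw [pow_add z, hz, add_assoc n, pow_add (-1 : R) n, hn.neg_one_pow]
  push_cast
  ring

theorem prod_range_two_mul_fold {M : Type*} [CommMonoid M] (f : ℕ → M) (s : ℕ) :
    ∏ k ∈ Finset.range (2 * s), f k = ∏ k ∈ Finset.range s, (f k * f (2 * s - 1 - k)) := by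
  rw [two_mul, Finset.prod_range_add, Finset.prod_mul_distrib]
  congr 1
  rw [← Finset.prod_range_reflect]
  refine Finset.prod_congr rfl fun k hk => ?_
  have := Finset.mem_range.1 hk
  congr 1
  omega

theorem prod_signed_choose {R : Type*} [CommRing R] {h : ℕ} (h2 : 2 ≤ h) :
    ∏ k ∈ Finset.range (2 * h), ((-1 : R) ^ (k + 1) *
        ((2 * h + 3).choose k + (2 * h + 3).choose (2 * h + k) : ℕ)) =
      (-1) ^ h * ((1 + (2 * h + 3).choose 3 : ℕ) * ((2 * h + 3) + (2 * h + 3).choose 2 : ℕ) *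
        ∏ k ∈ Finset.range (h - 2), ((2 * h + 3).choose (4 + k) : R)) ^ 2 := by
  obtain ⟨s, rfl⟩ := Nat.exists_eq_add_of_le h2
  have hz : ∀ k, (2 * (2 + s) + 3).choose (2 * (2 + s) + (4 + k)) = 0 := fun k =>
    Nat.choose_eq_zero_of_lt (by omega)
  have e0 : (2 * (2 + s) + 3).choose (2 * (2 + s) + 0) = (2 * (2 + s) + 3).choose 3 :=
    Nat.choose_symm_of_eq_add (by omega)
  have e1 : (2 * (2 + s) + 3).choose (2 * (2 + s) + 1) = (2 * (2 + s) + 3).choose 2 :=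
    Nat.choose_symm_of_eq_add (by omega)
  have e2 : (2 * (2 + s) + 3).choose (2 * (2 + s) + 2) = (2 * (2 + s) + 3) := by
    rw [Nat.choose_symm_of_eq_add (show _ = _ + 1 by omega), Nat.choose_one_right]
  have e3 : (2 * (2 + s) + 3).choose (2 * (2 + s) + 3) = 1 := Nat.choose_self _
  have hr : 2 * (2 + s) = 4 + 2 * s := by ring
  rw [show Finset.range (2 * (2 + s)) = Finset.range (4 + 2 * s) by rw [hr],
    Finset.prod_range_add, prod_range_two_mul_fold]
  have hp : ∀ k ∈ Finset.range s,
      ((-1 : R) ^ (4 + k + 1) * ((2 * (2 + s) + 3).choose (4 + k) +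
        (2 * (2 + s) + 3).choose (2 * (2 + s) + (4 + k)) : ℕ)) *
      ((-1 : R) ^ (4 + (2 * s - 1 - k) + 1) * ((2 * (2 + s) + 3).choose (4 + (2 * s - 1 - k)) +
        (2 * (2 + s) + 3).choose (2 * (2 + s) + (4 + (2 * s - 1 - k))) : ℕ)) =
      (-1) * ((2 * (2 + s) + 3).choose (4 + k) : R) ^ 2 := by
    intro k hk
    have hk := Finset.mem_range.1 hk
    rw [hz, hz, Nat.choose_symm_of_eq_add (show 2 * (2 + s) + 3 = 4 + (2 * s - 1 - k) + (4 + k)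
      by omega)]
    have : (-1 : R) ^ (4 + k + 1) * (-1) ^ (4 + (2 * s - 1 - k) + 1) = -1 := by
      rw [← pow_add]
      exact Odd.neg_one_pow ⟨s + 4, by omega⟩
    rw [mul_mul_mul_comm, this]
    push_cast
    ring
  have hq : ∏ k ∈ Finset.range s, (-1) * ((2 * (2 + s) + 3).choose (4 + k) : R) ^ 2 =
      (-1) ^ s * (∏ k ∈ Finset.range s, ((2 * (2 + s) + 3).choose (4 + k) : R)) ^ 2 := by
    rw [Finset.prod_mul_distrib, Finset.prod_const, Finset.card_range, Finset.prod_pow]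
  rw [Finset.prod_congr rfl hp, hq]
  simp only [Finset.prod_range_succ, Finset.prod_range_zero, e0, e1, e2, e3, Nat.choose_zero_right,
    Nat.choose_one_right, Nat.add_sub_cancel_left]
  push_cast
  ring

theorem prod_choose_mul_prod_factorial_s15 (s : ℕ) :
    (∏ k ∈ Finset.range s, (2 * s - 1).choose k) *
      ∏ i ∈ Finset.range s, ((2 * i).factorial ^ 2 * (2 * i + 1)) =
      (2 * s - 1).factorial ^ s := by
  have h1 : ∏ i ∈ Finset.range s, ((2 * i).factorial ^ 2 * (2 * i + 1)) =
      ∏ j ∈ Finset.range (2 * s), j.factorial := by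
    induction s with
    | zero => simp
    | succ s ih =>
      rw [Finset.prod_range_succ, ih, mul_add_one 2 s, Finset.prod_range_succ, Finset.prod_range_succ,
        Nat.factorial_succ]
      ring
  rw [h1, prod_range_two_mul_fold, ← Finset.prod_mul_distrib]
  rw [Finset.prod_congr rfl (g := fun _ => (2 * s - 1).factorial), Finset.prod_const,
    Finset.card_range]
  intro k hk
  have := Finset.mem_range.1 hk
  rw [← mul_assoc, Nat.choose_mul_factorial_mul_factorial (by omega)]

theorem prod_odd_mul_two_pow_mul_factorial_s15 (h : ℕ) :
    (∏ i ∈ Finset.range h, (2 * i + 1)) * (2 ^ h * h.factorial) = (2 * h).factorial := by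
  induction h with
  | zero => simp
  | succ h ih =>
    rw [Finset.prod_range_succ, mul_add_one 2 h, Nat.factorial_succ h, Nat.factorial_succ (2 * h + 1),
      Nat.factorial_succ (2 * h), ← ih]
    ring

theorem factorial_half_sq {p h : ℕ} [Fact p.Prime] (hp : p = 4 * h + 1) :
    ((2 * h).factorial : ZMod p) ^ 2 = -1 := by
  have hw := ZMod.wilsons_lemma p
  have h0 : ((4 * h + 1 : ℕ) : ZMod p) = 0 := by
    rw [← hp]
    exact ZMod.natCast_self p
  push_cast at h0
  rw [show p - 1 = 2 * (2 * h) by omega, ← Finset.prod_range_add_one_eq_factorial,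
    prod_range_two_mul_fold] at hw
  rw [← hw, ← Finset.prod_range_add_one_eq_factorial]
  push_cast
  rw [Finset.prod_mul_distrib, sq]
  congr 1
  have hneg : ∀ k ∈ Finset.range (2 * h),
      (((2 * (2 * h) - 1 - k : ℕ) : ZMod p) + 1) = (-1) * ((k : ZMod p) + 1) := by
    intro k hk
    have := Finset.mem_range.1 hk
    have h1 : ((2 * (2 * h) - 1 - k : ℕ) : ZMod p) + ((1 + k : ℕ) : ZMod p) =
        ((2 * (2 * h) : ℕ) : ZMod p) := by
      rw [← Nat.cast_add]
      congr 1
      omega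
    push_cast at h1
    linear_combination h1 + h0
  rw [Finset.prod_congr rfl hneg, Finset.prod_mul_distrib]
  simp [pow_mul]

theorem Dp_three_cast {p h : ℕ} [Fact p.Prime] (hp : p = 4 * h + 1) (h2 : 2 ≤ h) :
    (Dp p 3 : ZMod p) = ((2 * h : ℕ) : ZMod p) ^ (2 * h) * (((2 * h).factorial : ZMod p) ^ 2) ^ 3 *
      ((-1) ^ h * ((1 + (2 * h + 3).choose 3 : ℕ) * ((2 * h + 3) + (2 * h + 3).choose 2 : ℕ) *
        ∏ k ∈ Finset.range (h - 2), ((2 * h + 3).choose (4 + k) : ZMod p)) ^ 2) := by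
  have hn : (p - 1) / 2 = 2 * h := by omega
  have hcast : ∀ k : ℕ, 0 < k → k < p → (k : ZMod p) ≠ 0 := by
    intro k h0 hk hz
    exact absurd (Nat.le_of_dvd h0 ((ZMod.natCast_eq_zero_iff k p).1 hz)) (by omega)
  let x : Fin (2 * h) → ZMod p := fun i => ((i : ℕ) + 1 : ZMod p) ^ 2
  have hx0' : ∀ i : Fin (2 * h), ((i : ℕ) + 1 : ZMod p) ≠ 0 := fun i => by
    have := hcast (i + 1) (by omega) (by omega)
    exact_mod_cast this
  have hx0 : ∀ i, x i ≠ 0 := fun i => pow_ne_zero 2 (hx0' i)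
  have hx : ∀ i, x i ^ (2 * h) = 1 := fun i => by
    rw [← pow_mul, show 2 * (2 * h) = p - 1 by omega]
    exact ZMod.pow_card_sub_one_eq_one (hx0' i)
  have hinj : Function.Injective x := by
    intro i j hij
    have h1 : (((i : ℕ) : ZMod p) - (j : ℕ)) * (((i + j + 2 : ℕ) : ZMod p)) = 0 := by
      have hij' : (((i : ℕ) : ZMod p) + 1) ^ 2 = (((j : ℕ) : ZMod p) + 1) ^ 2 := hij
      push_cast
      linear_combination hij'
    rcases mul_eq_zero.1 h1 with h1 | h1
    · have h3 := (ZMod.natCast_eq_natCast_iff' _ _ _).1 (sub_eq_zero.1 h1)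
      rw [Nat.mod_eq_of_lt (by omega), Nat.mod_eq_of_lt (by omega)] at h3
      exact Fin.ext h3
    · exact absurd h1 (hcast _ (by omega) (by omega))
  have hmat : (Dp p 3 : ZMod p) =
      (Matrix.of fun i j => x j ^ 3 * ∑ k ∈ Finset.range (2 * h),
        ((-1 : ZMod p) ^ (k + 1) *
          ((2 * h + 3).choose k + (2 * h + 3).choose (2 * h + k) : ℕ)) * (x i / x j) ^ k).det := by
    rw [Dp, Int.cast_det, ← Matrix.det_reindex_self (finCongr hn)]
    congr 1
    ext i j
    simp only [Dmat, Matrix.reindex_apply, Matrix.submatrix_apply, Matrix.map_apply,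
      Matrix.of_apply, finCongr_symm, finCongr_apply_coe]
    rw [← sub_one_pow_of_pow_eq_one (even_two_mul h) (by omega)
      (by rw [div_pow, hx, hx, div_one] : (x i / x j) ^ (2 * h) = 1),
      ← jacobiSym.legendreSym.to_jacobiSym, Int.cast_mul, legendreSym.eq_pow,
      show p / 2 = 2 * h by omega]
    push_cast
    change (x i - x j) ^ 3 * (x i - x j) ^ (2 * h) = _
    have h3 : x i - x j = x j * (x i / x j - 1) := by
      have := hx0 j
      field_simp
    rw [h3, mul_pow, mul_pow (x j) _ (2 * h), hx]
    ring
  rw [hmat, det_mul_sum_div_pow x (fun j => x j ^ 3) hinj hx0 hx, prod_signed_choose h2,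
    Finset.prod_pow]
  congr 3
  rw [Finset.prod_pow, Fin.prod_univ_eq_prod_range (fun i => (i : ZMod p) + 1),
    ← Finset.prod_range_add_one_eq_factorial]
  push_cast
  rfl

theorem quadraticChar_eq_of_sq_eq_sq {F : Type*} [Field F] [Fintype F] [DecidableEq F]
    (hF : quadraticChar F (-1) = 1) {a b : F} (h : a ^ 2 = b ^ 2) :
    quadraticChar F a = quadraticChar F b := by
  rcases sq_eq_sq_iff_eq_or_eq_neg.1 h with rfl | rfl
  · rfl
  · rw [neg_eq_neg_one_mul, map_mul, hF, one_mul]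

theorem neg_one_pow_card_eq_prod {p m : ℕ} [Fact p.Prime] (hm : m < p) :
    (-1 : ℤ) ^ ((Finset.Ioc 0 m).filter (fun k : ℕ => jacobiSym k p = -1)).card =
      quadraticChar (ZMod p) (m.factorial : ZMod p) := by
  rw [← Finset.prod_Ico_id_eq_factorial, Nat.cast_prod, map_prod, ← Finset.prod_const,
    Finset.prod_filter]
  refine Finset.prod_congr (by ext; simp; omega) fun k hk => ?_
  have hk' := Finset.mem_Ico.1 hk
  have hk0 : (k : ZMod p) ≠ 0 := fun hz =>
    absurd (Nat.le_of_dvd (by omega) ((ZMod.natCast_eq_zero_iff k p).1 hz)) (by omega)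
  rw [← jacobiSym.legendreSym.to_jacobiSym, legendreSym, Int.cast_natCast]
  rcases quadraticChar_dichotomy hk0 with h | h <;> simp [h]

theorem jacobiSym_of_sq_eq_Dp_five (t : ℤ) (ht : 0 ≤ t) (htsq : t ^ 2 = Dp 5 3) :
    jacobiSym t 5 = -1 := by
  have hD : Dp 5 3 = 27 ^ 2 := by
    change Matrix.det (n := Fin 2) (Dmat 5 3) = _
    rw [Matrix.det_fin_two]
    change (((0 : ℕ) + 1 : ℤ) ^ 2 - ((0 : ℕ) + 1 : ℤ) ^ 2) ^ 3 *
        jacobiSym ((((0 : ℕ) + 1 : ℤ) ^ 2 - ((0 : ℕ) + 1 : ℤ) ^ 2)) 5 *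
      ((((1 : ℕ) + 1 : ℤ) ^ 2 - ((1 : ℕ) + 1 : ℤ) ^ 2) ^ 3 *
        jacobiSym ((((1 : ℕ) + 1 : ℤ) ^ 2 - ((1 : ℕ) + 1 : ℤ) ^ 2)) 5) -
      (((0 : ℕ) + 1 : ℤ) ^ 2 - ((1 : ℕ) + 1 : ℤ) ^ 2) ^ 3 *
        jacobiSym ((((0 : ℕ) + 1 : ℤ) ^ 2 - ((1 : ℕ) + 1 : ℤ) ^ 2)) 5 *
      ((((1 : ℕ) + 1 : ℤ) ^ 2 - ((0 : ℕ) + 1 : ℤ) ^ 2) ^ 3 *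
        jacobiSym ((((1 : ℕ) + 1 : ℤ) ^ 2 - ((0 : ℕ) + 1 : ℤ) ^ 2)) 5) = _
    norm_num
  rw [hD] at htsq
  obtain rfl : t = 27 := by nlinarith
  norm_num

theorem quadraticChar_of_sq_eq_Dp {p h : ℕ} [Fact p.Prime] (hp : p = 4 * h + 1) (h2 : 2 ≤ h)
    {t : ℤ} (ht : t ^ 2 = Dp p 3) :
    quadraticChar (ZMod p) (t : ZMod p) =
      quadraticChar (ZMod p) (h.factorial : ZMod p) *
        quadraticChar (ZMod p) ((if Even h then 5 else 3 : ℕ) : ZMod p) := by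
  have hpp : p.Prime := Fact.out
  have hp9 : p ≠ 9 := by
    rintro rfl
    exact absurd hpp (by norm_num)
  have hp13 : 13 ≤ p := by omega
  set χ := quadraticChar (ZMod p) with hχ
  have hcast : ∀ k : ℕ, 0 < k → k < p → (k : ZMod p) ≠ 0 := by
    intro k h0 hk hz
    exact absurd (Nat.le_of_dvd h0 ((ZMod.natCast_eq_zero_iff k p).1 hz)) (by omega)
  have hsq : ∀ a : ZMod p, a ≠ 0 → χ a * χ a = 1 := fun a ha => by
    rw [← sq]
    exact quadraticChar_sq_one ha
  have n2 : (2 : ZMod p) ≠ 0 := by exact_mod_cast hcast 2 (by omega) (by omega)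
  have n3 : (3 : ZMod p) ≠ 0 := by exact_mod_cast hcast 3 (by omega) (by omega)
  have n5 : (5 : ZMod p) ≠ 0 := by exact_mod_cast hcast 5 (by omega) (by omega)
  have n7 : (7 : ZMod p) ≠ 0 := by exact_mod_cast hcast 7 (by omega) (by omega)
  have s2 := hsq 2 n2
  have s3 := hsq 3 n3
  have s5 := hsq 5 n5
  have s7 := hsq 7 n7
  have h0 : 4 * (h : ZMod p) + 1 = 0 := by
    have : ((4 * h + 1 : ℕ) : ZMod p) = 0 := by
      rw [← hp]
      exact ZMod.natCast_self p
    exact_mod_cast this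
  have hf2 := factorial_half_sq hp
  set f : ZMod p := ((2 * h).factorial : ZMod p) with hf
  have hneg : χ (-1) = 1 := by
    rw [← hf2]
    refine quadraticChar_sq_one' fun hz => ?_
    rw [hz] at hf2
    simp at hf2
  have hχf : χ f = χ 2 := by
    have h1 : (1 + f) ^ 2 = 2 * f := by linear_combination hf2
    have hf0 : f ≠ 0 := fun hz => by
      rw [hz] at hf2
      simp at hf2
    have hne : 1 + f ≠ 0 := fun hz => by
      rw [hz] at h1
      simp [n2, hf0] at h1
    have h3 : χ 2 * χ f = 1 := by
      rw [← map_mul, ← h1]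
      exact quadraticChar_sq_one' hne
    linear_combination χ 2 * h3 - χ f * s2
  have hχ2 : χ 2 ^ h = χ 2 := by
    rcases Nat.even_or_odd h with he | ho
    · have : χ 2 = 1 := (quadraticChar_one_iff_isSquare n2).2
        ((ZMod.exists_sq_eq_two_iff (by omega)).2 (by obtain ⟨r, rfl⟩ := he; omega))
      rw [this, one_pow]
    · obtain ⟨r, rfl⟩ := ho
      rw [pow_succ, pow_mul, sq, s2, one_pow, one_mul]
  have hfac : ∀ k : ℕ, k < p → (k.factorial : ZMod p) ≠ 0 := fun k hk hz =>
    absurd ((Nat.Prime.dvd_factorial hpp).1 ((ZMod.natCast_eq_zero_iff _ p).1 hz)) (by omega)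
  have hh : χ (h.factorial : ZMod p) * χ (h.factorial : ZMod p) = 1 := hsq _ (hfac h (by omega))
  -- values of the small binomial coefficients modulo `p`
  have e1 : 2 * ((2 * h + 3 : ℕ) : ZMod p) = 5 := by
    push_cast
    linear_combination h0
  have e2 : 8 * ((2 * h + 3).choose 2 : ZMod p) = 15 := by
    have h1 := congrArg (Nat.cast (R := ZMod p))
      (Nat.descFactorial_eq_factorial_mul_choose (2 * h + 3) 2)
    simp [Nat.descFactorial, Nat.factorial] at h1
    linear_combination -4 * h1 + (4 * (h : ZMod p) + 9) * h0
  have e3 : 16 * ((2 * h + 3).choose 3 : ZMod p) = 5 := by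
    have h1 := congrArg (Nat.cast (R := ZMod p))
      (Nat.descFactorial_eq_factorial_mul_choose (2 * h + 3) 3)
    simp [Nat.descFactorial, Nat.factorial] at h1
    refine mul_left_cancel₀ n3 ?_
    linear_combination -8 * h1 + ((4 * (h : ZMod p) + 9) * (4 * h + 2) + 15) * h0
  have c1 : χ ((2 * h + 3 : ℕ) : ZMod p) = χ 2 * χ 5 := by
    rw [← e1, map_mul, ← mul_assoc, s2, one_mul]
  have x8 : χ 8 = χ 2 := by
    rw [show (8 : ZMod p) = 2 * 2 * 2 by norm_num, map_mul, map_mul, s2, one_mul]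
  have x16 : χ 16 = 1 := by
    rw [show (16 : ZMod p) = 8 * 2 by norm_num, map_mul, x8, s2]
  have c2 : χ ((2 * h + 3).choose 2 : ZMod p) = χ 2 * (χ 3 * χ 5) := by
    rw [← map_mul χ 3, show (3 * 5 : ZMod p) = 15 by norm_num, ← e2, map_mul, x8, ← mul_assoc, s2,
      one_mul]
  have c3 : χ ((2 * h + 3).choose 3 : ZMod p) = χ 5 := by
    rw [← e3, map_mul, x16, one_mul]
  have cA : χ ((1 + (2 * h + 3).choose 3 : ℕ) : ZMod p) = χ 3 * χ 7 := by
    rw [← map_mul, ← one_mul (χ _), ← x16, ← map_mul]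
    congr 1
    push_cast
    linear_combination e3
  have cB : χ (((2 * h + 3) + (2 * h + 3).choose 2 : ℕ) : ZMod p) = χ 2 * (χ 5 * χ 7) := by
    have : χ 8 * χ (((2 * h + 3) + (2 * h + 3).choose 2 : ℕ) : ZMod p) = χ 5 * χ 7 := by
      rw [← map_mul, ← map_mul]
      congr 1
      push_cast at e1 ⊢
      linear_combination e2 + 4 * e1
    rw [← this, x8, ← mul_assoc, s2, one_mul]
  set P : ZMod p := ∏ k ∈ Finset.range (h - 2), ((2 * h + 3).choose (4 + k) : ZMod p) with hP
  have hO : χ ((∏ i ∈ Finset.range h, (2 * i + 1) : ℕ) : ZMod p) = χ (h.factorial : ZMod p) := by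
    have h1 := congrArg (fun k : ℕ => χ (k : ZMod p)) (prod_odd_mul_two_pow_mul_factorial_s15 h)
    simp only [Nat.cast_mul, Nat.cast_pow, map_mul, map_pow, Nat.cast_ofNat, hχ2] at h1
    rw [← hf, hχf] at h1
    linear_combination (χ (h.factorial : ZMod p) * χ 2) * h1 -
      χ ((∏ i ∈ Finset.range h, (2 * i + 1) : ℕ) : ZMod p) * (χ 2 * χ 2 * hh + s2) +
      χ (h.factorial : ZMod p) * s2
  have hm : χ ((2 * h + 3).factorial : ZMod p) = χ 3 * χ 5 := by
    have h1 : 8 * ((2 * h + 3).factorial : ZMod p) = 3 * 5 * f := by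
      rw [Nat.factorial_succ (2 * h + 2), Nat.factorial_succ (2 * h + 1), Nat.factorial_succ]
      push_cast
      linear_combination f * ((4 * (h : ZMod p) + 9) * (4 * h + 2) + 15) * h0
    have h3 := congrArg χ h1
    rw [map_mul, map_mul, map_mul, x8, hχf] at h3
    linear_combination χ 2 * h3 - (χ ((2 * h + 3).factorial : ZMod p) - χ 3 * χ 5) * s2
  have hPval : χ 3 * χ 5 * χ P * (χ (h.factorial : ZMod p) * χ 5) = (χ 3 * χ 5) ^ (h + 2) := by
    have h1 := congrArg (fun k : ℕ => χ (k : ZMod p)) (prod_choose_mul_prod_factorial_s15 (h + 2))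
    have hfirst : χ ((∏ k ∈ Finset.range (h + 2), (2 * h + 3).choose k : ℕ) : ZMod p) =
        χ 3 * χ 5 * χ P := by
      rw [show h + 2 = 4 + (h - 2) by omega, Finset.prod_range_add, Nat.cast_mul, map_mul,
        Nat.cast_prod (R := ZMod p) _ (Finset.range (h - 2)), ← hP]
      simp only [Finset.prod_range_succ, Finset.prod_range_zero, Nat.choose_zero_right,
        Nat.choose_one_right, Nat.cast_mul, map_mul, c1, c2, c3, Nat.cast_one, map_one]
      linear_combination χ 3 * χ 5 * χ P * (χ 5 * χ 5 * s2 + s5)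
    have hsecond : χ ((∏ i ∈ Finset.range (h + 2), ((2 * i).factorial ^ 2 * (2 * i + 1)) : ℕ) :
        ZMod p) = χ (h.factorial : ZMod p) * χ 5 := by
      have hodd : χ ((2 * h + 1 : ℕ) : ZMod p) = χ 2 := by
        have h3 : (2 : ZMod p) * ((2 * h + 1 : ℕ) : ZMod p) = 1 := by
          push_cast
          linear_combination h0
        have h4 := congrArg χ h3
        rw [map_mul, map_one] at h4
        linear_combination χ 2 * h4 - χ ((2 * h + 1 : ℕ) : ZMod p) * s2
      have hsqf : χ ((∏ i ∈ Finset.range (h + 2), (2 * i).factorial ^ 2 : ℕ) : ZMod p) = 1 := by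
        rw [Finset.prod_pow, Nat.cast_pow]
        refine quadraticChar_sq_one' ?_
        rw [Nat.cast_prod]
        exact Finset.prod_ne_zero_iff.2 fun i hi =>
          hfac _ (by have := Finset.mem_range.1 hi; omega)
      rw [Finset.prod_mul_distrib, Nat.cast_mul, map_mul, hsqf, one_mul, Finset.prod_range_succ,
        Finset.prod_range_succ, Nat.cast_mul, Nat.cast_mul, map_mul, map_mul, hO, hodd,
        show 2 * (h + 1) + 1 = 2 * h + 3 by ring, c1]
      linear_combination χ (h.factorial : ZMod p) * χ 5 * s2
    rw [show 2 * (h + 2) - 1 = 2 * h + 3 by omega] at h1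
    simp only [Nat.cast_mul, map_mul, hfirst, hsecond] at h1
    rw [h1, Nat.cast_pow, map_pow, hm]
  have htP : χ (t : ZMod p) = χ 3 * χ 5 * χ P := by
    have hn : χ ((2 * h : ℕ) : ZMod p) = χ 2 := by
      have h1 : (-1) * 2 * ((2 * h : ℕ) : ZMod p) = 1 := by
        push_cast
        linear_combination -h0
      have h3 := congrArg χ h1
      rw [map_mul, map_mul, map_one, hneg] at h3
      linear_combination χ 2 * h3 - χ ((2 * h : ℕ) : ZMod p) * s2
    have key : (t : ZMod p) ^ 2 = (((2 * h : ℕ) : ZMod p) ^ h * f ^ (h + 3) *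
        (((1 + (2 * h + 3).choose 3 : ℕ) : ZMod p) *
          (((2 * h + 3) + (2 * h + 3).choose 2 : ℕ) : ZMod p) * P)) ^ 2 := by
      have := Dp_three_cast hp h2
      rw [← ht, Int.cast_pow, ← hf2] at this
      rw [this]
      ring
    rw [quadraticChar_eq_of_sq_eq_sq hneg key, ← hχ]
    simp only [map_mul, map_pow, cA, cB, hn, hχf, hχ2, pow_add]
    linear_combination χ 3 * χ 5 * χ P * (χ 2 ^ 6 * s7 + (χ 2 ^ 4 + χ 2 ^ 2 + 1) * s2)
  rw [← htP] at hPval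
  have hX : (χ 3 * χ 5) ^ 2 = 1 := by
    linear_combination χ 5 * χ 5 * s3 + s5
  rcases Nat.even_or_odd h with he | ho
  · rw [if_pos he]
    have hpow : (χ 3 * χ 5) ^ (h + 2) = 1 := by
      obtain ⟨r, rfl⟩ := he
      rw [show r + r + 2 = 2 * (r + 1) by ring, pow_mul, hX, one_pow]
    rw [hpow] at hPval
    push_cast
    linear_combination χ (h.factorial : ZMod p) * χ 5 * hPval -
      χ (t : ZMod p) * (χ 5 * χ 5 * hh + s5)
  · rw [if_neg (Nat.not_even_iff_odd.2 ho)]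
    have hpow : (χ 3 * χ 5) ^ (h + 2) = χ 3 * χ 5 := by
      obtain ⟨r, rfl⟩ := ho
      rw [show 2 * r + 1 + 2 = 2 * (r + 1) + 1 by ring, pow_succ, pow_mul, hX, one_pow, one_mul]
    rw [hpow] at hPval
    push_cast
    linear_combination χ (h.factorial : ZMod p) * χ 5 * hPval -
      χ (t : ZMod p) * (χ 5 * χ 5 * hh + s5) + χ (h.factorial : ZMod p) * χ 3 * s5

/-- For a prime `p ≡ 1 (mod 4)`, letting `t = √D_p^(3)` be the nonnegative
integer with `t² = D_p^(3)`, the Legendre symbol `(t/p)` equals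
`(−1)^N · (p/(4 + (−1)^((p−1)/4)))`, where `N = #{k : 0 < k < p/4, (k/p) = −1}` and
`4 + (−1)^((p−1)/4)` is `5` if `(p−1)/4` is even and `3` if it is odd. -/
theorem stmt15 (p : ℕ) (hp : p.Prime) (h4 : p % 4 = 1)
    (t : ℤ) (ht : 0 ≤ t) (htsq : t ^ 2 = Dp p 3) :
    jacobiSym t p =
      (-1) ^ ((Finset.Ioc 0 (p / 4)).filter (fun k : ℕ => jacobiSym k p = -1)).card *
        jacobiSym p (if Even ((p - 1) / 4) then 5 else 3) := by
  have hpf : Fact p.Prime := ⟨hp⟩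
  obtain ⟨h, rfl⟩ : ∃ h, p = 4 * h + 1 := ⟨p / 4, by omega⟩
  have e1 : (4 * h + 1 - 1) / 4 = h := by omega
  have e2 : (4 * h + 1) / 4 = h := by omega
  rw [e1, e2, neg_one_pow_card_eq_prod (by omega)]
  rcases Nat.lt_or_ge h 2 with h2 | h2
  · obtain rfl : h = 1 := by
      have := hp.two_le
      omega
    rw [show 4 * 1 + 1 = 5 from rfl] at htsq
    simp [jacobiSym_of_sq_eq_Dp_five t ht htsq]
    norm_num
  · have key := quadraticChar_of_sq_eq_Dp rfl h2 htsq
    rw [jacobiSym.quadratic_reciprocity_one_mod_four h4 (by split_ifs <;> decide),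
      ← jacobiSym.legendreSym.to_jacobiSym, ← jacobiSym.legendreSym.to_jacobiSym, legendreSym,
      legendreSym, key, Int.cast_natCast]
end

section
/- Let R be a commutative ring with identity, let b_0, b_1, …, b_{n−1} ∈ R, let P(x) = Σ_{i=0}^{n−1} b_i x^i, and let X_1, …, X_n, Y_1, …, Y_n ∈ R. Then det[P(X_i Y_j)]_{1≤i,j≤n} = (∏_{i=0}^{n−1} b_i) · ∏_{1≤i<j≤n} (X_i − X_j)(Y_i − Y_j). -/
/-- Let `R` be a commutative ring, `P(x) = Σ_{i=0}^{n−1} b_i x^i` and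
`X_1, …, X_n, Y_1, …, Y_n ∈ R`. Then
`det[P(X_i Y_j)]_{1≤i,j≤n} = (∏_{i=0}^{n−1} b_i) · ∏_{i<j} (X_i − X_j)(Y_i − Y_j)`. -/
theorem stmt16 {R : Type*} [CommRing R] (n : ℕ) (b X Y : Fin n → R) :
    (Matrix.of (fun i j : Fin n => ∑ k : Fin n, b k * (X i * Y j) ^ (k : ℕ))).det =
      (∏ k : Fin n, b k) *
        ∏ i : Fin n, ∏ j ∈ Finset.Ioi i, (X i - X j) * (Y i - Y j) := by
  have factorization :
      Matrix.of (fun i j : Fin n => ∑ k : Fin n, b k * (X i * Y j) ^ (k : ℕ)) =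
        Matrix.vandermonde X * Matrix.diagonal b * (Matrix.vandermonde Y).transpose := by
    ext i j
    rw [Matrix.of_apply, Matrix.mul_apply]
    simp only [Matrix.mul_diagonal, Matrix.transpose_apply, Matrix.vandermonde_apply]
    exact Finset.sum_congr rfl fun k _ => by ring
  rw [factorization, Matrix.det_mul, Matrix.det_mul, Matrix.det_diagonal, Matrix.det_transpose,
    Matrix.det_vandermonde, Matrix.det_vandermonde, mul_comm (∏ i, ∏ j ∈ Finset.Ioi i, _),
    mul_assoc, ← Finset.prod_mul_distrib]
  congr 1
  refine Finset.prod_congr rfl fun i _ => ?_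
  rw [← Finset.prod_mul_distrib]
  exact Finset.prod_congr rfl fun j _ => by ring
end

section
/- Let n be a positive integer and let a be a positive integer coprime to n, and let τ_a be the permutation of ℤ/nℤ given by multiplication by a. Then the sign of τ_a equals: the Jacobi symbol (a/n) if n is odd; 1 if n ≡ 2 (mod 4); and (−1)^{(a−1)/2} if n ≡ 0 (mod 4). -/
namespace ZMod

open Equiv

/-- Multiplication by `a`, as a permutation of `ZMod n`. -/
def mulPerm (n : ℕ) {a : ℕ} (h : a.Coprime n) : Perm (ZMod n) :=
  MulAction.toPermHom _ _ (unitOfCoprime a h)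

@[simp]
theorem mulPerm_apply {n a : ℕ} (h : a.Coprime n) (x : ZMod n) : mulPerm n h x = a * x := rfl

theorem natCast_val_add_mul_val_bijective (m k : ℕ) [NeZero m] [NeZero k] :
    Function.Bijective
      (fun p : ZMod m × ZMod k ↦ ((p.1.val + m * p.2.val : ℕ) : ZMod (m * k))) := by
  rw [Fintype.bijective_iff_injective_and_card]
  refine ⟨?_, by simp [ZMod.card]⟩
  rintro ⟨i, j⟩ ⟨i', j'⟩ h
  have hlt (i : ZMod m) (j : ZMod k) : i.val + m * j.val < m * k := by
    have hi := i.val_lt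
    have hj : m * (j.val + 1) ≤ m * k := Nat.mul_le_mul_left m j.val_lt
    linarith
  rw [natCast_eq_natCast_iff, Nat.ModEq, Nat.mod_eq_of_lt (hlt _ _),
    Nat.mod_eq_of_lt (hlt _ _)] at h
  dsimp only at h
  have hm : 0 < m := Nat.pos_of_neZero m
  have h1 := congrArg (· % m) h
  have h2 := congrArg (· / m) h
  simp only [Nat.add_mul_mod_self_left, Nat.mod_eq_of_lt (val_lt _)] at h1
  simp only [Nat.add_mul_div_left _ _ hm, Nat.div_eq_of_lt (val_lt _), zero_add] at h2
  exact Prod.ext (val_injective m h1) (val_injective k h2)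

theorem val_natCast_mul_val (m a : ℕ) [NeZero m] (i : ZMod m) :
    ((a : ZMod m) * i).val = a * i.val % m := by
  conv_lhs => rw [← natCast_zmod_val i, ← Nat.cast_mul, val_natCast]

theorem sign_mulPerm_mul {m k a : ℕ} [NeZero m] [NeZero k] (hm : a.Coprime m) (hk : a.Coprime k)
    (h : a.Coprime (m * k)) :
    Perm.sign (mulPerm (m * k) h) = Perm.sign (mulPerm m hm) ^ k * Perm.sign (mulPerm k hk) ^ m *
      ∏ i : ZMod m, Perm.sign (Equiv.addLeft ((a * i.val / m : ℕ) : ZMod k)) := by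
  set c : ZMod m → ZMod k := fun i ↦ ((a * i.val / m : ℕ) : ZMod k) with hc
  have key : Perm.sign (prodCongrLeft (fun _ : ZMod k ↦ mulPerm m hm) *
      prodCongrRight (fun i : ZMod m ↦ Equiv.addLeft (c i) * mulPerm k hk)) =
      Perm.sign (mulPerm (m * k) h) := by
    refine Perm.sign_eq_sign_of_equiv _ _
      (Equiv.ofBijective _ (natCast_val_add_mul_val_bijective m k)) ?_
    rintro ⟨i, j⟩
    have hj : c i + (a : ZMod k) * j = ((a * i.val / m + a * j.val : ℕ) : ZMod k) := by
      simp [hc]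
    simp only [Perm.mul_apply, prodCongrRight_apply, prodCongrLeft_apply, Equiv.ofBijective_apply,
      mulPerm_apply, coe_addLeft, hj, val_natCast_mul_val, val_natCast]
    rw [← Nat.cast_mul, natCast_eq_natCast_iff, ← Nat.mul_mod_mul_left]
    refine (Nat.ModEq.add_left _ (Nat.mod_modEq _ _)).trans ?_
    rw [mul_add, ← add_assoc, Nat.mod_add_div]
    exact congrArg (· % _) (by ring)
  rw [← key, Perm.sign_mul, Perm.sign_prodCongrLeft, Perm.sign_prodCongrRight]
  simp only [Perm.sign_mul, Finset.prod_mul_distrib, Finset.prod_const, Finset.card_univ, card]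
  rw [mul_assoc, mul_comm (∏ i, _)]

theorem sign_addLeft_of_odd {k : ℕ} [NeZero k] (hk : Odd k) (c : ZMod k) :
    Perm.sign (Equiv.addLeft c) = 1 := by
  have h : Perm.sign (Equiv.addLeft c) ^ k = 1 := by
    rw [← map_pow, Equiv.nsmul_addLeft]
    simp
  rcases Int.units_eq_one_or (Perm.sign (Equiv.addLeft c)) with h' | h'
  · exact h'
  · rw [h', hk.neg_one_pow] at h
    exact absurd h (by decide)

theorem sign_addLeft_natCast_two (c : ℕ) :
    Perm.sign (Equiv.addLeft (c : ZMod 2)) = (-1) ^ c := by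
  have h : Perm.sign (Equiv.addLeft (1 : ZMod 2)) = -1 := by decide
  rw [← h, ← map_pow, Equiv.nsmul_addLeft]
  simp

theorem sign_mulPerm_mul_of_odd {m k a : ℕ} [NeZero m] [NeZero k] (hm' : Odd m) (hk' : Odd k)
    (hm : a.Coprime m) (hk : a.Coprime k) (h : a.Coprime (m * k)) :
    Perm.sign (mulPerm (m * k) h) = Perm.sign (mulPerm m hm) * Perm.sign (mulPerm k hk) := by
  have hodd (u : ℤˣ) {n : ℕ} (hn : Odd n) : u ^ n = u := by
    rcases Int.units_eq_one_or u with rfl | rfl <;> simp [hn.neg_one_pow]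
  rw [sign_mulPerm_mul hm hk h]
  simp [sign_addLeft_of_odd hk', hodd _ hm', hodd _ hk']

theorem sum_val_mul_two (m : ℕ) [NeZero m] : (∑ i : ZMod m, i.val) * 2 = m * (m - 1) := by
  obtain _ | m := m
  · exact absurd rfl (NeZero.ne 0)
  · exact (congrArg (· * 2) (Fin.sum_univ_eq_sum_range (fun i ↦ i) (m + 1))).trans
      (Finset.sum_range_id_mul_two (m + 1))

theorem sum_mul_val_div_mul_two {m a : ℕ} [NeZero m] (h : a.Coprime m) :
    (∑ i : ZMod m, a * i.val / m) * 2 = (a - 1) * (m - 1) := by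
  have hm : 0 < m := Nat.pos_of_neZero m
  have hperm : ∑ i : ZMod m, a * i.val % m = ∑ i : ZMod m, i.val := by
    simp only [← val_natCast_mul_val]
    exact Equiv.sum_comp (mulPerm m h) val
  have hsum : m * (∑ i : ZMod m, a * i.val / m) + ∑ i : ZMod m, i.val =
      a * ∑ i : ZMod m, i.val := by
    rw [← hperm, Finset.mul_sum, ← Finset.sum_add_distrib, hperm, Finset.mul_sum]
    exact Finset.sum_congr rfl fun i _ ↦ Nat.div_add_mod _ _
  have hval := sum_val_mul_two m
  obtain _ | a := a
  · simp
  · refine Nat.eq_of_mul_eq_mul_left hm ?_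
    rw [Nat.add_sub_cancel, mul_left_comm m a, ← hval]
    linarith

theorem sign_mulPerm_mul_two {m a : ℕ} [NeZero m] (h : a.Coprime (m * 2)) :
    Perm.sign (mulPerm (m * 2) h) = (-1) ^ ((a - 1) * (m - 1) / 2) := by
  have hm : a.Coprime m := h.coprime_mul_right_right
  have hk : a.Coprime 2 := h.coprime_mul_left_right
  have h2 : mulPerm 2 hk = 1 := by
    have : unitOfCoprime a hk = 1 := Subsingleton.elim _ _
    ext x
    simp [mulPerm, this]
  rw [sign_mulPerm_mul hm hk h, h2, ← sum_mul_val_div_mul_two hm]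
  simp only [sign_addLeft_natCast_two, Finset.prod_pow_eq_pow_sum, Int.units_sq, map_one, one_pow,
    one_mul]
  simp

/-- **The lemma of Zolotarev**. -/
theorem sign_mulPerm_prime {p a : ℕ} [Fact p.Prime] (hp : p ≠ 2) (h : a.Coprime p) :
    (Perm.sign (mulPerm p h) : ℤ) = legendreSym p a := by
  obtain ⟨g, hg⟩ := IsCyclic.exists_monoid_generator (α := (ZMod p)ˣ)
  have hodd : Odd p := (Fact.out : p.Prime).odd_of_ne_two hp
  have hchar : ringChar (ZMod p) ≠ 2 := by rwa [ringChar_zmod_n]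
  have hquad : quadraticChar (ZMod p) g = -1 := by
    rw [quadraticChar_eq_neg_one_iff_not_one g.ne_zero]
    intro hg1
    obtain ⟨u, hu⟩ := quadraticChar_exists_neg_one' hchar
    obtain ⟨i, rfl⟩ := hg u
    rw [Units.val_pow_eq_pow_val, map_pow, hg1, one_pow] at hu
    exact absurd hu (by decide)
  have hg1 : (g : ZMod p) ≠ 1 := by
    intro hg1
    simp [hg1] at hquad
  set σ := MulAction.toPermHom (ZMod p)ˣ (ZMod p) g with hσ
  have hfix (x : ZMod p) : σ x ≠ x ↔ x ≠ 0 := by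
    simp [hσ, Units.smul_def, mul_left_eq_self₀, hg1]
  have hcycle : σ.IsCycle := by
    refine ⟨1, (hfix 1).2 one_ne_zero, fun y hy ↦ ?_⟩
    obtain ⟨i, hi⟩ := hg (Units.mk0 y ((hfix y).1 hy))
    refine ⟨i, ?_⟩
    rw [zpow_natCast, hσ, ← map_pow]
    change g ^ i = _ at hi
    simp [hi, Units.smul_def]
  have hsupp : σ.support = Finset.univ.erase 0 := by
    ext x
    rw [Perm.mem_support, hfix]
    simp
  have hsign : Perm.sign σ = -1 := by
    rw [hcycle.sign, hsupp, Finset.card_erase_of_mem (Finset.mem_univ _), Finset.card_univ, card,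
      (Nat.Odd.sub_odd hodd odd_one).neg_one_pow]
  obtain ⟨i, hi⟩ := hg (unitOfCoprime a h)
  change g ^ i = _ at hi
  have ha : (a : ZMod p) = (g : ZMod p) ^ i := by
    rw [← coe_unitOfCoprime a h, ← hi, Units.val_pow_eq_pow_val]
  rw [mulPerm, ← hi, map_pow, map_pow, hsign, legendreSym, Int.cast_natCast, ha, map_pow, hquad]
  simp

theorem sign_mulPerm_of_odd {n a : ℕ} [hn0 : NeZero n] (hn : Odd n) (h : a.Coprime n) :
    (Perm.sign (mulPerm n h) : ℤ) = jacobiSym a n := by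
  induction n using Nat.recOnMul generalizing hn0 with
  | zero => exact absurd hn (by decide)
  | one =>
    have : mulPerm 1 h = 1 := Equiv.ext fun x ↦ Subsingleton.elim (α := Fin 1) _ x
    simp [this]
  | prime p hp =>
    have : Fact p.Prime := ⟨hp⟩
    rw [← jacobiSym.legendreSym.to_jacobiSym,
      ← sign_mulPerm_prime (by rintro rfl; exact absurd hn (by decide)) h]
  | mul m k hm hk =>
    have hkodd := Nat.Odd.of_mul_right hn
    have hmodd := Nat.Odd.of_mul_left hn
    have : NeZero m := ⟨hmodd.pos.ne'⟩
    have : NeZero k := ⟨hkodd.pos.ne'⟩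
    rw [jacobiSym.mul_right, ← hm hmodd h.coprime_mul_right_right,
      ← hk hkodd h.coprime_mul_left_right, ← Units.val_mul,
      ← sign_mulPerm_mul_of_odd hmodd hkodd]

end ZMod

/-- Let `n` be a positive integer and `a` a positive integer coprime to `n`,
and let `τ_a` be the permutation of `ℤ/nℤ` given by multiplication by `a`. Then
`sgn(τ_a)` equals the Jacobi symbol `(a/n)` if `n` is odd, `1` if `n ≡ 2 (mod 4)`,
and `(−1)^((a−1)/2)` if `n ≡ 0 (mod 4)`. -/
theorem stmt17 (n : ℕ) [NeZero n] (a : ℕ) (ha : 0 < a) (han : Nat.Coprime a n)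
    (τ : Equiv.Perm (ZMod n)) (hτ : ∀ x : ZMod n, τ x = (a : ZMod n) * x) :
    (Equiv.Perm.sign τ : ℤ) =
      if n % 2 = 1 then jacobiSym a n
      else if n % 4 = 2 then 1
      else (-1) ^ ((a - 1) / 2) := by
  obtain rfl : τ = ZMod.mulPerm n han := Equiv.ext hτ
  by_cases hn : n % 2 = 1
  · rw [if_pos hn, ZMod.sign_mulPerm_of_odd (Nat.odd_iff.2 hn)]
  · rw [if_neg hn]
    obtain ⟨m, rfl⟩ : ∃ m, n = m * 2 := ⟨n / 2, by omega⟩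
    have : NeZero m := ⟨by rintro rfl; exact NeZero.ne (0 * 2) (zero_mul 2)⟩
    obtain ⟨b, rfl⟩ : ∃ b, a = 2 * b + 1 :=
      (Nat.coprime_two_right.1 han.coprime_mul_left_right)
    have hexp : (2 * b + 1 - 1) * (m - 1) / 2 = b * (m - 1) := by
      rw [Nat.add_sub_cancel, mul_assoc, Nat.mul_div_cancel_left _ two_pos]
    have hb : (2 * b + 1 - 1) / 2 = b := by omega
    rw [ZMod.sign_mulPerm_mul_two, hexp, hb]
    have hm : 0 < m := Nat.pos_of_neZero m
    split_ifs with hn4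
    · have : Even (m - 1) := by rw [Nat.even_iff]; omega
      simp [(this.mul_left b).neg_one_pow]
    · have : Odd (m - 1) := by rw [Nat.odd_iff]; omega
      simp [mul_comm b, pow_mul, this.neg_one_pow]
end

section
/- Let q be an odd prime power and let F_q be the finite field with q elements. The map x ↦ x^{−1} is a permutation of the set of nonzero squares of F_q, and its sign equals (−1)^{(q−3)(q−5)/8}. -/
open Finset in
theorem FiniteField.two_mul_card_nonzero_isSquare_add_one {F : Type*} [Field F] [Fintype F]
    [DecidableEq F] (hF : ringChar F ≠ 2) :
    2 * #{x : F | x ≠ 0 ∧ IsSquare x} + 1 = Fintype.card F := by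
  have hpoint (a : F) : quadraticChar F a + 1 =
      (if a ≠ 0 ∧ IsSquare a then 2 else 0) + (if a = 0 then 1 else 0) := by
    by_cases ha : a = 0
    · simp [ha]
    · by_cases hs : IsSquare a
      · simp [ha, hs, (quadraticChar_one_iff_isSquare ha).2 hs]
      · simp [ha, hs, quadraticChar_neg_one_iff_not_isSquare.2 hs]
  have hsum := Finset.sum_congr (rfl : (univ : Finset F) = univ) fun a _ => hpoint a
  rw [sum_add_distrib, quadraticChar_sum_zero hF, sum_add_distrib, ← sum_filter] at hsum
  simp only [sum_const, sum_ite_eq', mem_univ, if_true, card_univ, nsmul_eq_mul] at hsum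
  lia

open Finset in
theorem FiniteField.card_nonzero_isSquare_eq_inv {F : Type*} [Field F] [Fintype F]
    [DecidableEq F] (hF : ringChar F ≠ 2) :
    #{x : F | (x ≠ 0 ∧ IsSquare x) ∧ x⁻¹ = x} = if Fintype.card F % 4 = 3 then 1 else 2 := by
  have hinv (x : F) (hx : x ≠ 0) : x⁻¹ = x ↔ x = 1 ∨ x = -1 := by
    rw [← mul_eq_one_iff_inv_eq₀ hx, mul_self_eq_one_iff]
  split_ifs with h
  · have hneg : ¬IsSquare (-1 : F) := by simpa [FiniteField.isSquare_neg_one_iff] using h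
    refine card_eq_one.2 ⟨1, ?_⟩
    ext x
    simp only [mem_filter, mem_univ, true_and, mem_singleton]
    constructor
    · rintro ⟨⟨hx, hs⟩, hi⟩
      exact ((hinv x hx).1 hi).resolve_right fun hx' => hneg (hx' ▸ hs)
    · rintro rfl
      simp
  · have hneg : IsSquare (-1 : F) := FiniteField.isSquare_neg_one_iff.2 h
    refine card_eq_two.2 ⟨1, -1, (Ring.neg_one_ne_one_of_char_ne_two hF).symm, ?_⟩
    ext x
    simp only [mem_filter, mem_univ, true_and, mem_insert, mem_singleton]
    constructor
    · rintro ⟨⟨hx, -⟩, hi⟩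
      exact (hinv x hx).1 hi
    · rintro (rfl | rfl)
      · simp
      · simp [hneg, inv_neg]

theorem neg_one_pow_half_sub_fixed_eq {q n m : ℕ} (hq : 3 ≤ q) (hn : 2 * n + 1 = q)
    (hm : m = if q % 4 = 3 then 1 else 2) :
    (-1 : ℤ) ^ ((n - m) / 2) = (-1) ^ ((q - 3) * (q - 5) / 8) := by
  obtain ⟨k, rfl | rfl⟩ := Nat.even_or_odd' n
  · rw [if_neg (by lia)] at hm
    obtain ⟨j, rfl⟩ : ∃ j, k = j + 1 := ⟨k - 1, by lia⟩
    have hexp : (q - 3) * (q - 5) / 8 = j + 2 * (j * j) := by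
      rw [show q - 3 = 4 * j + 2 by lia, show q - 5 = 4 * j by lia]
      exact Nat.div_eq_of_eq_mul_left (by norm_num) (by ring)
    rw [hexp, show (2 * (j + 1) - m) / 2 = j by lia, pow_add, pow_mul (-1 : ℤ) 2]
    simp
  · rw [if_pos (by lia)] at hm
    obtain rfl | ⟨j, rfl⟩ : k = 0 ∨ ∃ j, k = j + 1 := by
      rcases k with _ | j
      · exact Or.inl rfl
      · exact Or.inr ⟨j, rfl⟩
    · simp [hm, ← hn]
    · have hexp : (q - 3) * (q - 5) / 8 = (j + 1) + 2 * ((j + 1) * j) := by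
        rw [show q - 3 = 4 * (j + 1) by lia, show q - 5 = 4 * j + 2 by lia]
        exact Nat.div_eq_of_eq_mul_left (by norm_num) (by ring)
      rw [hexp, show (2 * (j + 1) + 1 - m) / 2 = j + 1 by lia, pow_add _ (j + 1),
        pow_mul (-1 : ℤ) 2]
      simp


/-- Let `q` be an odd prime power and `F_q` the finite field with `q`
elements. Then `x ↦ x⁻¹` is a permutation of the set `S` of nonzero squares of `F_q`,
and its sign equals `(−1)^((q−3)(q−5)/8)`. -/
theorem stmt18 {F : Type*} [Field F] [Fintype F] [DecidableEq F] (q : ℕ)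
    (hcard : Fintype.card F = q) (hodd : Odd q) :
    (∃ σ : Equiv.Perm {x : F // x ≠ 0 ∧ IsSquare x},
        ∀ x : {x : F // x ≠ 0 ∧ IsSquare x}, (σ x : F) = (x : F)⁻¹) ∧
      ∀ σ : Equiv.Perm {x : F // x ≠ 0 ∧ IsSquare x},
        (∀ x : {x : F // x ≠ 0 ∧ IsSquare x}, (σ x : F) = (x : F)⁻¹) →
          (Equiv.Perm.sign σ : ℤ) = (-1) ^ ((q - 3) * (q - 5) / 8) := by
  have hF : ringChar F ≠ 2 := fun h =>
    Nat.not_even_iff_odd.2 hodd (hcard ▸ Nat.even_iff.2 (FiniteField.even_card_of_char_two h))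
  refine ⟨?_, fun σ hσ => ?_⟩
  · let inv (x : {x : F // x ≠ 0 ∧ IsSquare x}) : {x : F // x ≠ 0 ∧ IsSquare x} :=
      ⟨(x : F)⁻¹, inv_ne_zero x.2.1, x.2.2.inv⟩
    exact ⟨Function.Involutive.toPerm inv fun x => Subtype.ext (inv_inv (x : F)), fun _ => rfl⟩
  · have hsq : σ ^ 2 = 1 := by
      ext x
      simp [sq, hσ]
    have hfixed : Fintype.card (Function.fixedPoints σ) =
        if q % 4 = 3 then 1 else 2 := by
      rw [← hcard, ← FiniteField.card_nonzero_isSquare_eq_inv hF, ← Fintype.card_subtype]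
      refine Fintype.card_congr ((Equiv.subtypeEquivRight fun x => ?_).trans
        (Equiv.subtypeSubtypeEquivSubtypeInter (fun x : F => x ≠ 0 ∧ IsSquare x)
          fun x => x⁻¹ = x))
      rw [Function.mem_fixedPoints_iff, ← hσ x, Subtype.ext_iff]
    have hsquares := FiniteField.two_mul_card_nonzero_isSquare_add_one hF
    rw [← Fintype.card_subtype, hcard] at hsquares
    have hq : 3 ≤ q := by
      have := hcard ▸ Fintype.one_lt_card (α := F)
      obtain ⟨k, rfl⟩ := hodd
      lia
    rw [Equiv.Perm.sign_of_pow_two_eq_one hsq]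
    push_cast
    exact neg_one_pow_half_sub_fixed_eq hq hsquares hfixed
end

section
/- For every prime p with p ≡ 1 (mod 4), the congruence ∏_{1≤i<j≤(p−1)/2} (j² − i²) ≡ −((p−1)/2)! (mod p) holds. -/
/-- A shifted form of Wilson's theorem. -/
theorem ZMod.factorial_mul_factorial (p : ℕ) [Fact p.Prime] (a b : ℕ) (h : a + b + 1 = p) :
    (a.factorial : ZMod p) * b.factorial = (-1) ^ (a + 1) := by
  induction a generalizing b with
  | zero =>
    have hb : p - 1 = b := by omega
    have hw := ZMod.wilsons_lemma p
    rw [hb] at hw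
    simp [hw]
  | succ a ih =>
    have hr := ih (b + 1) (by omega)
    have hs : ((a + 1 : ℕ) : ZMod p) + ((b + 1 : ℕ) : ZMod p) = 0 := by
      rw [← Nat.cast_add, show a + 1 + (b + 1) = p by omega, ZMod.natCast_self]
    rw [Nat.factorial_succ] at hr ⊢
    push_cast at hr hs ⊢
    rw [pow_succ, ← hr]
    linear_combination (a.factorial * b.factorial : ZMod p) * hs

theorem factorial_mul_prod_sq_sub_sq (n k : ℕ) (h : k ≤ n) :
    ((n - k).factorial : ℤ) * ((n + 1) * ∏ i ∈ Finset.Icc 1 k, (((n + 1 : ℕ) : ℤ) ^ 2 - (i : ℤ) ^ 2)) =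
      (n + 1 + k).factorial := by
  induction k with
  | zero => simp [Nat.factorial_succ, mul_comm]
  | succ k ih =>
    have hr := ih (by omega)
    obtain ⟨d, rfl⟩ := Nat.exists_eq_add_of_le h
    rw [Finset.prod_Icc_succ_top (by omega), ← Nat.add_assoc, Nat.factorial_succ (_ + k)]
    rw [show k + 1 + d - k = d + 1 by omega, Nat.factorial_succ] at hr
    rw [show k + 1 + d - (k + 1) = d by omega]
    push_cast at hr ⊢
    rw [← hr]
    ring

theorem prod_sq_sub_sq_mul_factorial (n : ℕ) :
    (∏ i ∈ Finset.Icc 1 n, ∏ j ∈ Finset.Ioc i n, ((j : ℤ) ^ 2 - (i : ℤ) ^ 2)) * n.factorial =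
      ∏ k ∈ Finset.range n, ((2 * k + 1).factorial : ℤ) := by
  induction n with
  | zero => simp
  | succ n ih =>
    have hk := factorial_mul_prod_sq_sub_sq n n le_rfl
    have hp : ∏ i ∈ Finset.Icc 1 n, ∏ j ∈ Finset.Ioc i (n + 1), ((j : ℤ) ^ 2 - (i : ℤ) ^ 2) =
        (∏ i ∈ Finset.Icc 1 n, ∏ j ∈ Finset.Ioc i n, ((j : ℤ) ^ 2 - (i : ℤ) ^ 2)) *
          ∏ i ∈ Finset.Icc 1 n, (((n + 1 : ℕ) : ℤ) ^ 2 - (i : ℤ) ^ 2) := by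
      rw [← Finset.prod_mul_distrib]
      refine Finset.prod_congr rfl fun i hi => ?_
      rw [Finset.prod_Ioc_succ_top (Finset.mem_Icc.mp hi).2]
    rw [Finset.prod_Icc_succ_top (by omega), Finset.Ioc_self, Finset.prod_empty, mul_one, hp,
      Finset.prod_range_succ, ← ih, show 2 * n + 1 = n + 1 + n by ring, ← hk, Nat.factorial_succ]
    simp only [Nat.sub_self, Nat.factorial_zero, Nat.cast_mul, Nat.cast_add, Nat.cast_one]
    ring

theorem ZMod.prod_factorial_odd (p m : ℕ) [Fact p.Prime] (h : p = 4 * m + 1) :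
    ∏ k ∈ Finset.range (2 * m), ((2 * k + 1).factorial : ZMod p) = 1 := by
  rw [two_mul, Finset.prod_range_add, ← Finset.prod_range_reflect (fun k => (_ : ZMod p)) m,
    ← Finset.prod_mul_distrib]
  refine Finset.prod_eq_one fun k hk => ?_
  have hk := Finset.mem_range.mp hk
  rw [ZMod.factorial_mul_factorial p _ _ (by omega)]
  exact Even.neg_one_pow ⟨m - 1 - k + 1, by omega⟩

/-- For every prime `p ≡ 1 (mod 4)`,
`∏_{1 ≤ i < j ≤ (p−1)/2} (j² − i²) ≡ −((p−1)/2)! (mod p)`. -/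
theorem stmt19 (p : ℕ) (hp : p.Prime) (h4 : p % 4 = 1) :
    (∏ i ∈ Finset.Icc 1 ((p - 1) / 2), ∏ j ∈ Finset.Ioc i ((p - 1) / 2),
        ((j : ℤ) ^ 2 - (i : ℤ) ^ 2)) ≡
      -(Nat.factorial ((p - 1) / 2) : ℤ) [ZMOD p] := by
  have : Fact p.Prime := ⟨hp⟩
  obtain ⟨m, hm⟩ : ∃ m, p = 4 * m + 1 := ⟨p / 4, by omega⟩
  have hn : (p - 1) / 2 = 2 * m := by omega
  rw [hn, ← ZMod.intCast_eq_intCast_iff]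
  have hf : ((2 * m).factorial : ZMod p) * (2 * m).factorial = -1 := by
    rw [ZMod.factorial_mul_factorial p _ _ (by omega)]
    exact Odd.neg_one_pow ⟨m, rfl⟩
  have hq := congrArg (Int.cast : ℤ → ZMod p) (prod_sq_sub_sq_mul_factorial (2 * m))
  have ho := ZMod.prod_factorial_odd p m hm
  rw [Int.cast_mul, Int.cast_prod (f := fun k : ℕ => ((2 * k + 1).factorial : ℤ))] at hq
  simp only [Int.cast_natCast, Int.cast_neg] at hq ⊢
  rw [ho] at hq
  linear_combination (-((2 * m).factorial : ZMod p)) * hq + (Int.cast (∏ i ∈ Finset.Icc 1 (2 * m),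
    ∏ j ∈ Finset.Ioc i (2 * m), ((j : ℤ) ^ 2 - (i : ℤ) ^ 2)) : ZMod p) * hf
end
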